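/- arXiv:0706.2707 — 2 statements merged into one kernel-verified Lean document; each statement's English description precedes it below -/
import Mathlib

section
/- The Jacobson radical R(n,p) of Σ(n,p) is spanned as an F_p-vector space by all differences B̄_q − B̄_r with q ≈ r together with all elements B̄_q for which some value occurs among the components of q with multiplicity p or more; consequently dim_{F_p} R(n,p) = 2^{n−1} − g(n,p). -/
open scoped Classical

set_option synthInstance.maxHeartbeats 1000000
set_option maxHeartbeats 1000000

noncomputable section

/-- The group algebra `F_p[S_n]`. -/
abbrev GroupAlg (n p : ℕ) : Type := MonoidAlgebra (ZMod p) (Equiv.Perm (Fin n))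

/-- The descent set of a permutation `σ` of `{1,…,n}` (1-based positions):
`k ∈ {1,…,n-1}` is a descent if `σ(k) > σ(k+1)`.  (With 0-based `Fin n` indices this
compares the images at indices `k-1` and `k`.) -/
def descSet {n : ℕ} (σ : Equiv.Perm (Fin n)) : Set ℕ :=
  {k | ∃ h : k < n, 0 < k ∧ σ ⟨k, h⟩ < σ ⟨k - 1, by omega⟩}

/-- The set of proper partial sums `{a_1, a_1+a_2, …, a_1+⋯+a_{s-1}}` of a composition. -/
def properPartialSums {n : ℕ} (q : Composition n) : Set ℕ :=
  {m | ∃ i : ℕ, 0 < i ∧ i < q.length ∧ m = q.sizeUpTo i}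

/-- `B̄_q`: the sum of all permutations whose descent set is contained in the set of
proper partial sums of `q`. -/
def Bel (n p : ℕ) (q : Composition n) : GroupAlg n p :=
  ∑ σ ∈ Finset.univ.filter
      (fun σ : Equiv.Perm (Fin n) => descSet σ ⊆ properPartialSums q),
    MonoidAlgebra.of (ZMod p) (Equiv.Perm (Fin n)) σ

/-- The p-modular descent algebra `Σ(n,p)`, as a subalgebra of the group algebra. -/
def descentAlgebra (n p : ℕ) : Subalgebra (ZMod p) (GroupAlg n p) :=
  Algebra.adjoin (ZMod p) (Set.range (Bel n p))

/-- `B̄_q` as an element of `Σ(n,p)`. -/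
def BelS (n p : ℕ) (q : Composition n) : descentAlgebra n p :=
  ⟨Bel n p q, Algebra.subset_adjoin ⟨q, rfl⟩⟩

/-- The Jacobson radical `R(n,p)` of `Σ(n,p)`. -/
def descentRadical (n p : ℕ) : Ideal (descentAlgebra n p) :=
  (⊥ : Ideal (descentAlgebra n p)).jacobson

/-- `R(n,p)` viewed as an `F_p`-subspace of the group algebra. -/
def descentRadicalSubmodule (n p : ℕ) : Submodule (ZMod p) (GroupAlg n p) :=
  Submodule.map (descentAlgebra n p).val.toLinearMap
    ((descentRadical n p).restrictScalars (ZMod p))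

/-- `Y_m`: the span of the `B̄_q` with `q` having at least `m` components. -/
def Ysub (n p m : ℕ) : Submodule (ZMod p) (GroupAlg n p) :=
  Submodule.span (ZMod p) {x | ∃ q : Composition n, m ≤ q.length ∧ x = Bel n p q}

/-- `T`: the span of all differences `B̄_q - B̄_r` with `q ≈ r`. -/
def Tsub (n p : ℕ) : Submodule (ZMod p) (GroupAlg n p) :=
  Submodule.span (ZMod p)
    {x | ∃ q r : Composition n, q.blocks.Perm r.blocks ∧ x = Bel n p q - Bel n p r}

/-- `g(n,p)`: the number of partitions of `n` with no part divisible by `p`. -/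
def gPart (n p : ℕ) : ℕ := Set.ncard {π : n.Partition | ∀ i ∈ π.parts, ¬ p ∣ i}

/-- `g(n,p)`: the number of conjugacy classes of `p`-regular elements of `S_n`. -/
def gReg (n p : ℕ) : ℕ :=
  Set.ncard {c : ConjClasses (Equiv.Perm (Fin n)) | ∀ σ ∈ c.carrier, (orderOf σ).Coprime p}

/-- The Young character `χ_q`: `χ_q(σ)` is the number of ordered set partitions
`(P_1,…,P_s)` of `{1,…,n}` with `|P_i| = a_i`, each of whose blocks is `σ`-invariant. -/
def youngChar {n : ℕ} (q : Composition n) (σ : Equiv.Perm (Fin n)) : ℕ :=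
  (Finset.univ.filter (fun P : Fin q.length → Finset (Fin n) =>
    (∀ i, (P i).card = q.blocksFun i) ∧
    (∀ i j, i ≠ j → Disjoint (P i) (P j)) ∧
    (∀ x, ∃ i, x ∈ P i) ∧
    (∀ i, ∀ x ∈ P i, σ x ∈ P i))).card

/-- `χ̃_q`: the Young character with values reduced mod `p`. -/
def youngCharMod (n p : ℕ) (q : Composition n) : Equiv.Perm (Fin n) → ZMod p :=
  fun σ => (youngChar q σ : ZMod p)

/-- `G(n,p)`: the span of the mod-`p` Young characters. -/
def Gnp (n p : ℕ) : Submodule (ZMod p) (Equiv.Perm (Fin n) → ZMod p) :=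
  Submodule.span (ZMod p) (Set.range (youngCharMod n p))

/-- `S(q,r)`: matrices with row sums `q` and column sums `r`. -/
def SMat {n : ℕ} (q r : Composition n) : Set (Matrix (Fin q.length) (Fin r.length) ℕ) :=
  {Z | (∀ i, ∑ j, Z i j = q.blocksFun i) ∧ (∀ j, ∑ i, Z i j = r.blocksFun j)}

/-- `w(Z)`: the list of nonzero entries of `Z` read row by row. -/
def wList {s t : ℕ} (Z : Matrix (Fin s) (Fin t) ℕ) : List ℕ :=
  ((List.finRange s).flatMap fun i => ((List.finRange t).map fun j => Z i j)).filter
    (fun x => x ≠ 0)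

/-- One merging step: replace two adjacent components by their sum. -/
def mergeStep (l l' : List ℕ) : Prop :=
  ∃ (u v : List ℕ) (a b : ℕ), l = u ++ a :: b :: v ∧ l' = u ++ (a + b) :: v

/-- `coarsens l l'` (`l ⪯ l'` on compositions): `l'` is obtained from `l` by repeatedly
replacing adjacent components by their sum. -/
def coarsens (l l' : List ℕ) : Prop := Relation.ReflTransGen mergeStep l l'

/-- A face of the braid arrangement, as a total preorder of `{1,…,n}`. -/
@[ext] structure Face (n : ℕ) where
  rel : Fin n → Fin n → Prop
  total : ∀ x y, rel x y ∨ rel y x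
  trans : ∀ x y z, rel x y → rel y z → rel x z

namespace Face

theorem perm_inv_apply_self {α : Type*} (σ : Equiv.Perm α) (x : α) : σ⁻¹ (σ x) = x :=
  σ.symm_apply_apply x

theorem perm_apply_inv_self {α : Type*} (σ : Equiv.Perm α) (x : α) : σ (σ⁻¹ x) = x :=
  σ.apply_symm_apply x

variable {n : ℕ}

theorem refl (r : Face n) (x : Fin n) : r.rel x x := (r.total x x).elim id id

instance : Fintype (Face n) :=
  Fintype.ofInjective (fun r : Face n => r.rel) fun _ _ h => Face.ext h

/-- The opposite of the Tits product: `a * b` is `b` with ties broken by `a`. -/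
instance : Monoid (Face n) where
  mul a b :=
    { rel := fun x y => b.rel x y ∧ (b.rel y x → a.rel x y)
      total := fun x y => by have := a.total x y; have := b.total x y; tauto
      trans := fun x y z h₁ h₂ =>
        ⟨b.trans x y z h₁.1 h₂.1, fun h => a.trans x y z
          (h₁.2 (b.trans _ _ _ h₂.1 h)) (h₂.2 (b.trans _ _ _ h h₁.1))⟩ }
  one := ⟨fun _ _ => True, fun _ _ => Or.inl trivial, fun _ _ _ _ _ => trivial⟩
  mul_assoc a b c := by
    ext x y
    change (_ ∧ (_ → _ ∧ (_ → _))) ↔ ((_ ∧ (_ → _)) ∧ (_ ∧ (_ → _) → _))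
    tauto
  one_mul a := by
    ext x y
    exact ⟨fun h => h.1, fun h => ⟨h, fun _ => trivial⟩⟩
  mul_one a := by
    ext x y
    exact ⟨fun h => h.2 trivial, fun h => ⟨trivial, fun _ => h⟩⟩

theorem mul_rel (a b : Face n) (x y : Fin n) :
    (a * b).rel x y ↔ b.rel x y ∧ (b.rel y x → a.rel x y) := Iff.rfl

instance : MulAction (Equiv.Perm (Fin n)) (Face n) where
  smul σ r :=
    { rel := fun x y => r.rel (σ⁻¹ x) (σ⁻¹ y)
      total := fun _ _ => r.total _ _
      trans := fun _ _ _ => r.trans _ _ _ }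
  one_smul _ := rfl
  mul_smul _ _ _ := rfl

theorem smul_rel (σ : Equiv.Perm (Fin n)) (r : Face n) (x y : Fin n) :
    (σ • r).rel x y ↔ r.rel (σ⁻¹ x) (σ⁻¹ y) := Iff.rfl

theorem smul_mul' (σ : Equiv.Perm (Fin n)) (a b : Face n) : σ • (a * b) = σ • a * σ • b := rfl

theorem smul_one' (σ : Equiv.Perm (Fin n)) : σ • (1 : Face n) = 1 := rfl

/-- The strict linear order obtained from `r` by breaking ties with the natural order. -/
def Before (r : Face n) (x y : Fin n) : Prop := r.rel x y ∧ (r.rel y x → x < y)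

theorem before_irrefl (r : Face n) (x : Fin n) : ¬ r.Before x x :=
  fun h => lt_irrefl _ (h.2 (r.refl x))

theorem before_trans (r : Face n) {x y z : Fin n} (h₁ : r.Before x y) (h₂ : r.Before y z) :
    r.Before x z :=
  ⟨r.trans _ _ _ h₁.1 h₂.1, fun h =>
    (h₁.2 (r.trans _ _ _ h₂.1 h)).trans (h₂.2 (r.trans _ _ _ h h₁.1))⟩

theorem before_total (r : Face n) {x y : Fin n} (h : x ≠ y) : r.Before x y ∨ r.Before y x := by
  have := r.total x y
  have := lt_or_gt_of_ne h
  unfold Before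
  tauto

theorem card_before_lt (r : Face n) (x : Fin n) :
    (Finset.univ.filter fun z => r.Before z x).card < n := by
  conv_rhs => rw [← Fintype.card_fin n]
  exact Finset.card_lt_univ_of_notMem (x := x) (by simpa using r.before_irrefl x)

/-- The position of `x` in the linear order `Before`. -/
def pos (r : Face n) (x : Fin n) : Fin n :=
  ⟨(Finset.univ.filter fun z => r.Before z x).card, r.card_before_lt x⟩

theorem pos_val (r : Face n) (x : Fin n) :
    (r.pos x : ℕ) = (Finset.univ.filter fun z => r.Before z x).card := rfl

theorem pos_lt_pos (r : Face n) {x y : Fin n} (h : r.Before x y) : r.pos x < r.pos y := by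
  rw [Fin.lt_def, pos_val, pos_val]
  refine Finset.card_lt_card (Finset.ssubset_iff_of_subset ?_ |>.2 ⟨x, ?_, ?_⟩)
  · intro z hz
    simp only [Finset.mem_filter, Finset.mem_univ, true_and] at hz ⊢
    exact r.before_trans hz h
  · simpa using h
  · simpa using r.before_irrefl x

theorem pos_injective (r : Face n) : Function.Injective r.pos := by
  intro x y h
  by_contra hne
  rcases r.before_total hne with h' | h'
  · exact (r.pos_lt_pos h').ne h
  · exact (r.pos_lt_pos h').ne h.symm

/-- The permutation (as a word) listing the blocks of `r` in order, each increasingly. -/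
def word (r : Face n) : Equiv.Perm (Fin n) :=
  (Equiv.ofBijective r.pos (Finite.injective_iff_bijective.1 r.pos_injective)).symm

theorem word_inv_apply (r : Face n) (x : Fin n) : r.word⁻¹ x = r.pos x := rfl

theorem before_iff (r : Face n) {x y : Fin n} : r.Before x y ↔ r.word⁻¹ x < r.word⁻¹ y := by
  refine ⟨r.pos_lt_pos, fun h => ?_⟩
  have hne : x ≠ y := by rintro rfl; exact lt_irrefl _ h
  exact (r.before_total hne).resolve_right fun h' => lt_asymm h (r.pos_lt_pos h')

theorem word_eq (r : Face n) (σ : Equiv.Perm (Fin n))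
    (h : ∀ x y, r.Before x y → σ⁻¹ x < σ⁻¹ y) : r.word = σ := by
  have h' : ∀ x y, r.Before x y ↔ σ⁻¹ x < σ⁻¹ y := by
    refine fun x y => ⟨h x y, fun hlt => ?_⟩
    have hne : x ≠ y := by rintro rfl; exact lt_irrefl _ hlt
    exact (r.before_total hne).resolve_right fun h' => lt_asymm hlt (h _ _ h')
  refine inv_injective (Equiv.ext fun x => Fin.ext ?_)
  rw [word_inv_apply]
  change (Finset.univ.filter fun z => r.Before z x).card = _
  simp_rw [h']
  rw [← Fin.card_Iio (σ⁻¹ x)]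
  refine Finset.card_bij (fun z _ => σ⁻¹ z) (by simp) (by simp) fun b hb => ⟨σ b, ?_, ?_⟩
  · simpa using hb
  · simp

theorem word_mul (s r : Face n) : (s * r).word = s.word * (s.word⁻¹ • r).word := by
  refine word_eq _ _ fun x y h => ?_
  rw [mul_inv_rev, Equiv.Perm.mul_apply, Equiv.Perm.mul_apply, ← before_iff]
  have hs : s.Before x y ↔ _ := s.before_iff
  simp only [Before, mul_rel, smul_rel, inv_inv, perm_apply_inv_self] at h hs ⊢
  tauto

/-- The face with the consecutive blocks cut out by `S` (positions). -/
def std (n : ℕ) (S : Set ℕ) : Face n where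
  rel x y := ∀ s ∈ S, s ≤ x.1 → s ≤ y.1
  total x y := by
    rcases le_total x.1 y.1 with h | h
    · exact Or.inl fun s _ hs => hs.trans h
    · exact Or.inr fun s _ hs => hs.trans h
  trans x y z h₁ h₂ s hs h := h₂ s hs (h₁ s hs h)

/-- The number of elements strictly below `y`. -/
def below (r : Face n) (y : Fin n) : ℕ := (Finset.univ.filter fun x => ¬ r.rel y x).card

/-- The type of a face: the set of nonzero sizes of proper initial unions of blocks. -/
def type (r : Face n) : Set ℕ := {m | 0 < m ∧ ∃ y, m = r.below y}

theorem below_smul (σ : Equiv.Perm (Fin n)) (r : Face n) (y : Fin n) :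
    (σ • r).below y = r.below (σ⁻¹ y) := by
  refine Finset.card_bij (fun z _ => σ⁻¹ z) (by simp [smul_rel]) (by simp)
    fun b hb => ⟨σ b, ?_, ?_⟩
  · simpa [smul_rel] using hb
  · simp

theorem type_smul (σ : Equiv.Perm (Fin n)) (r : Face n) : (σ • r).type = r.type := by
  ext m
  simp only [type, below_smul, Set.mem_ofPred_eq]
  exact and_congr_right fun _ => ⟨fun ⟨y, h⟩ => ⟨_, h⟩, fun ⟨y, h⟩ => ⟨σ y, by simpa using h⟩⟩

theorem type_std {S : Set ℕ} (hS : ∀ s ∈ S, 0 < s ∧ s < n) : (std n S).type = S := by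
  have key : ∀ (y : Fin n) (s : ℕ), s ≤ y → s ∈ S → (∀ t ∈ S, t ≤ y → t ≤ s) →
      (std n S).below y = s := by
    intro y s hsy hs hmax
    rw [below]
    refine Eq.trans ?_ (Fin.card_Iio (⟨s, (hS s hs).2⟩ : Fin n))
    congr 1
    ext x
    rw [Finset.mem_filter, Finset.mem_Iio]
    simp only [Finset.mem_univ, true_and, std, Fin.lt_def]
    push Not
    exact ⟨fun ⟨t, ht, hty, htx⟩ => htx.trans_le (hmax t ht hty), fun h => ⟨s, hs, hsy, h⟩⟩
  ext m
  constructor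
  · rintro ⟨hm, y, rfl⟩
    rw [below, Finset.card_pos] at hm
    obtain ⟨x, hx⟩ := hm
    rw [Finset.mem_filter] at hx
    simp only [Finset.mem_univ, true_and, std] at hx
    push Not at hx
    obtain ⟨t, ht, hty, -⟩ := hx
    let P : ℕ → Prop := fun s => s ∈ S
    have hP : P (Nat.findGreatest P y) := Nat.findGreatest_spec (P := P) hty ht
    rw [key y _ (Nat.findGreatest_le _) hP fun t ht hty => Nat.le_findGreatest hty ht]
    exact hP
  · intro hm
    exact ⟨(hS m hm).1, ⟨m, (hS m hm).2⟩, (key _ m le_rfl hm fun t _ h => h).symm⟩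

theorem below_le_pos (r : Face n) {x y : Fin n} (h : r.rel y x) : r.below y ≤ r.pos x := by
  rw [below, pos_val]
  refine Finset.card_le_card fun z hz => ?_
  simp only [Finset.mem_filter, Finset.mem_univ, true_and] at hz ⊢
  have hzx : ¬ r.rel x z := fun h' => hz (r.trans _ _ _ h h')
  exact ⟨(r.total z x).resolve_right hzx, fun h' => absurd h' hzx⟩

theorem pos_lt_below (r : Face n) {x y : Fin n} (h : ¬ r.rel y x) : (r.pos x : ℕ) < r.below y := by
  rw [below, pos_val]
  refine Finset.card_lt_card (Finset.ssubset_iff_of_subset ?_ |>.2 ⟨x, ?_, ?_⟩)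
  · intro z hz
    simp only [Finset.mem_filter, Finset.mem_univ, true_and] at hz ⊢
    exact fun h' => h (r.trans _ _ _ h' hz.1)
  · simpa using h
  · simpa using r.before_irrefl x

theorem eq_word_smul_std (r : Face n) : r = r.word • std n r.type := by
  ext x y
  rw [smul_rel]
  change _ ↔ ∀ s ∈ r.type, s ≤ (r.pos x : ℕ) → s ≤ (r.pos y : ℕ)
  constructor
  · rintro h s ⟨-, a, rfl⟩ hs
    refine r.below_le_pos (r.trans _ _ _ ?_ h)
    by_contra hax
    exact absurd (r.pos_lt_below hax) (not_lt.2 hs)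
  · intro h
    by_contra hxy
    have hlt := r.pos_lt_below hxy
    have := h (r.below x) ⟨by omega, x, rfl⟩ (r.below_le_pos (r.refl x))
    omega

theorem descSet_word_subset (r : Face n) : descSet r.word ⊆ r.type := by
  rintro k ⟨hk, hk0, hlt⟩
  set a := r.word ⟨k - 1, by omega⟩ with ha
  set b := r.word ⟨k, hk⟩ with hb
  have hab : r.Before a b := by
    rw [before_iff, ha, hb]
    simp only [perm_inv_apply_self, Fin.lt_def]
    omega
  have hnba : ¬ r.rel b a := fun h => lt_asymm hlt (hab.2 h)
  refine ⟨hk0, b, ?_⟩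
  have h1 : (r.pos a : ℕ) = k - 1 := by
    rw [← word_inv_apply, ha, perm_inv_apply_self]
  have h2 : (r.pos b : ℕ) = k := by
    rw [← word_inv_apply, hb, perm_inv_apply_self]
  have h3 := r.pos_lt_below hnba
  have h4 := r.below_le_pos (r.refl b)
  omega

theorem word_smul_std {S : Set ℕ} (σ : Equiv.Perm (Fin n)) (h : descSet σ ⊆ S) :
    (σ • std n S).word = σ := by
  refine word_eq _ _ fun x y hxy => ?_
  obtain ⟨i, rfl⟩ := σ.surjective x
  obtain ⟨j, rfl⟩ := σ.surjective y
  simp only [Before, smul_rel, perm_inv_apply_self] at hxy ⊢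
  by_contra hij
  rw [not_lt] at hij
  have hij' : (j : ℕ) ≤ i := hij
  have hnoS : ∀ s ∈ S, s ≤ i.1 → s ≤ j.1 := hxy.1
  have hlt : σ i < σ j := hxy.2 fun s _ hs => hs.trans hij'
  have hmono : ∀ d : ℕ, ∀ hd : j.1 + d ≤ i.1, σ j ≤ σ ⟨j.1 + d, by omega⟩ := by
    intro d
    induction d with
    | zero => intro _; exact le_rfl
    | succ d ih =>
      intro hd
      refine (ih (by omega)).trans (not_lt.1 fun hdesc => ?_)
      have := hnoS (j.1 + (d + 1)) (h ⟨by omega, by omega, hdesc⟩) hd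
      omega
  have := hmono (i.1 - j.1) (by omega)
  simp only [Nat.add_sub_cancel' hij'] at this
  exact absurd hlt (not_lt.2 this)

/-- Words of faces of type `S` are exactly the permutations with descents in `S`. -/
theorem sum_type_eq {M : Type*} [AddCommMonoid M] {S : Set ℕ} (hS : ∀ s ∈ S, 0 < s ∧ s < n)
    (f : Equiv.Perm (Fin n) → M) :
    ∑ r ∈ Finset.univ.filter (fun r : Face n => r.type = S), f r.word =
      ∑ σ ∈ Finset.univ.filter (fun σ : Equiv.Perm (Fin n) => descSet σ ⊆ S), f σ := by
  refine Finset.sum_bij' (fun r _ => r.word) (fun σ _ => σ • std n S) ?_ ?_ ?_ ?_ ?_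
  · intro r hr
    simp only [Finset.mem_filter, Finset.mem_univ, true_and] at hr ⊢
    exact hr ▸ r.descSet_word_subset
  · intro σ _
    simp only [Finset.mem_filter, Finset.mem_univ, true_and]
    rw [type_smul, type_std hS]
  · intro r hr
    simp only [Finset.mem_filter, Finset.mem_univ, true_and] at hr
    rw [← hr]
    exact r.eq_word_smul_std.symm
  · intro σ hσ
    simp only [Finset.mem_filter, Finset.mem_univ, true_and] at hσ
    exact word_smul_std σ hσ
  · intro _ _
    rfl

theorem exists_descSet_eq {S : Set ℕ} (hS : ∀ s ∈ S, 0 < s ∧ s < n) :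
    ∃ σ : Equiv.Perm (Fin n), descSet σ = S := by
  let r : Face n := ⟨fun x y => (std n S).rel y x, fun x y => (std n S).total y x,
    fun x y z h₁ h₂ => (std n S).trans z y x h₂ h₁⟩
  refine ⟨r.word⁻¹, Set.ext fun k => ?_⟩
  constructor
  · rintro ⟨hk, hk0, hlt⟩
    rw [← before_iff] at hlt
    by_contra hkS
    have hrel : (std n S).rel ⟨k, hk⟩ ⟨k - 1, by omega⟩ := by
      intro s hs hsk
      have : s ≠ k := fun h => hkS (h ▸ hs)
      change s ≤ k at hsk
      change s ≤ k - 1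
      omega
    have := hlt.2 hrel
    simp only [Fin.lt_def] at this
    omega
  · intro hk
    refine ⟨(hS k hk).2, (hS k hk).1, ?_⟩
    rw [← before_iff]
    refine ⟨fun s _ hs => ?_, fun h => ?_⟩
    · change s ≤ k - 1 at hs
      change s ≤ k
      omega
    · have := h k hk le_rfl
      change k ≤ k - 1 at this
      have := (hS k hk).1
      omega

end Face

theorem Composition.bounds_of_mem_properPartialSums {n : ℕ} (q : Composition n) :
    ∀ s ∈ properPartialSums q, 0 < s ∧ s < n := by
  rintro s ⟨i, hi0, hi, rfl⟩
  have h1 := (q.monotone_sizeUpTo (show 1 ≤ i by omega)).trans_lt' (q.sizeUpTo_strict_mono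
    (show 0 < q.length by omega))
  have h2 := (q.sizeUpTo_strict_mono hi).trans_le (q.sizeUpTo_le (i + 1))
  exact ⟨by simpa using h1, h2⟩

theorem Composition.mem_boundaries_iff {n : ℕ} (q : Composition n) (j : Fin (n + 1)) :
    j ∈ q.boundaries ↔ j.1 ∈ properPartialSums q ∨ j.1 = 0 ∨ j.1 = n := by
  simp only [Composition.boundaries, Finset.mem_map, Finset.mem_univ, true_and]
  constructor
  · rintro ⟨i, rfl⟩
    by_cases h0 : i.1 = 0
    · right; left
      change q.sizeUpTo i = 0
      simp [h0]
    by_cases h1 : i.1 = q.length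
    · right; right
      change q.sizeUpTo i = n
      simp [h1]
    · exact Or.inl ⟨i, by omega, by omega, rfl⟩
  · rintro (⟨i, _, hi, h⟩ | h | h)
    · exact ⟨⟨i, by omega⟩, Fin.ext h.symm⟩
    · exact ⟨0, by ext; simpa using h.symm⟩
    · exact ⟨Fin.last _, by ext; simpa using h.symm⟩

theorem properPartialSums_injective (n : ℕ) :
    Function.Injective (properPartialSums : Composition n → Set ℕ) := by
  intro q r h
  apply (compositionEquiv n).injective
  apply CompositionAsSet.ext
  change q.boundaries = r.boundaries
  ext j
  rw [q.mem_boundaries_iff, r.mem_boundaries_iff, h]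

/-- A finite linear order, given by its relation, is order isomorphic to some `Fin m`. -/
theorem exists_equiv_fin_le_iff {Q : Type*} [Fintype Q] (le : Q → Q → Prop)
    (le_refl : ∀ a, le a a) (le_trans : ∀ a b c, le a b → le b c → le a c)
    (le_antisymm : ∀ a b, le a b → le b a → a = b) (le_total : ∀ a b, le a b ∨ le b a) :
    ∃ e : Q ≃ Fin (Fintype.card Q), ∀ a b, e a ≤ e b ↔ le a b := by
  let _ : LinearOrder Q :=
    { le := le
      lt := fun a b => le a b ∧ ¬ le b a
      lt_iff_le_not_ge := fun _ _ => Iff.rfl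
      le_refl := le_refl
      le_trans := le_trans
      le_antisymm := le_antisymm
      le_total := le_total
      toDecidableLE := Classical.decRel _ }
  exact ⟨(Fintype.orderIsoFinOfCardEq Q rfl).symm.toEquiv, fun a b =>
    (Fintype.orderIsoFinOfCardEq Q rfl).symm.le_iff_le⟩

namespace Setoid

variable {n : ℕ} (X : Setoid (Fin n))

/-- The size of a block of a set partition. -/
def blockSize (c : Quotient X) : ℕ := (Finset.univ.filter fun x : Fin n => Quotient.mk X x = c).card

/-- The multiset of block sizes of a set partition. -/
def blockSizes : Multiset ℕ := Finset.univ.val.map X.blockSize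

variable {X}

/-- An ordering of the blocks of a set partition, as a face. -/
def toFace (e : Quotient X ≃ Fin (Fintype.card (Quotient X))) : Face n where
  rel x y := e ⟦x⟧ ≤ e ⟦y⟧
  total _ _ := le_total _ _
  trans _ _ _ := le_trans

/-- The composition of block sizes of an ordered set partition. -/
def toComposition (e : Quotient X ≃ Fin (Fintype.card (Quotient X))) : Composition n where
  blocks := List.ofFn fun i => X.blockSize (e.symm i)
  blocks_pos := by
    intro i hi
    obtain ⟨j, rfl⟩ := List.mem_ofFn.1 hi
    obtain ⟨x, hx⟩ := Quotient.exists_rep (e.symm j)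
    exact Finset.card_pos.2 ⟨x, by simpa using hx⟩
  blocks_sum := by
    rw [List.sum_ofFn, e.symm.sum_comp X.blockSize]
    simp only [blockSize]
    rw [← Finset.card_eq_sum_card_fiberwise (f := Quotient.mk X) (s := Finset.univ)
      (fun _ _ => Finset.mem_coe.2 (Finset.mem_univ _))]
    simp

theorem coe_blocks_toComposition (e : Quotient X ≃ Fin (Fintype.card (Quotient X))) :
    ((toComposition e).blocks : Multiset ℕ) = X.blockSizes := by
  rw [blockSizes, ← Multiset.map_univ_val_equiv e.symm, Multiset.map_map]
  exact (Fin.univ_val_map _).symm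

theorem length_toComposition (e : Quotient X ≃ Fin (Fintype.card (Quotient X))) :
    (toComposition e).length = Fintype.card (Quotient X) := List.length_ofFn

theorem below_toFace (e : Quotient X ≃ Fin (Fintype.card (Quotient X))) (y : Fin n) :
    (toFace e).below y = (toComposition e).sizeUpTo (e ⟦y⟧) := by
  rw [Composition.sizeUpTo, toComposition, List.sum_take_ofFn, Face.below]
  simp only [blockSize]
  rw [Finset.card_eq_sum_card_fiberwise (f := fun x => e ⟦x⟧)
    (t := Finset.univ.filter fun i => i.1 < (e ⟦y⟧).1)]
  · refine Finset.sum_congr rfl fun i hi => congrArg _ (Finset.ext fun x => ?_)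
    rw [Finset.mem_filter, Finset.mem_filter, Finset.mem_filter]
    simp only [Finset.mem_filter, Finset.mem_univ, true_and, toFace, not_le] at hi ⊢
    rw [Equiv.eq_symm_apply]
    constructor
    · exact fun h => h.2
    · intro h
      exact ⟨by rw [h]; exact hi, h⟩
  · intro x hx
    rw [Finset.mem_coe, Finset.mem_filter] at hx ⊢
    simpa [toFace] using hx

theorem type_toFace (e : Quotient X ≃ Fin (Fintype.card (Quotient X))) :
    (toFace e).type = properPartialSums (toComposition e) := by
  ext m
  have hlen := length_toComposition e
  constructor
  · rintro ⟨hm, y, rfl⟩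
    rw [below_toFace] at hm ⊢
    refine ⟨e ⟦y⟧, Nat.pos_of_ne_zero fun h => ?_, ?_, rfl⟩
    · simp [h] at hm
    · rw [hlen]
      exact (e ⟦y⟧).2
  · intro hm
    refine ⟨((toComposition e).bounds_of_mem_properPartialSums m hm).1, ?_⟩
    obtain ⟨i, hi0, hi, rfl⟩ := hm
    obtain ⟨x, hx⟩ := Quotient.exists_rep (e.symm ⟨i, hlen ▸ hi⟩)
    refine ⟨x, ?_⟩
    rw [below_toFace, hx, Equiv.apply_symm_apply]

theorem toFace_injective :
    Function.Injective (toFace : (Quotient X ≃ Fin (Fintype.card (Quotient X))) → Face n) := by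
  intro e f h
  have key : ∀ a b, e a ≤ e b ↔ f a ≤ f b := by
    intro a b
    induction a using Quotient.ind
    induction b using Quotient.ind
    exact iff_of_eq (congrFun (congrFun (congrArg Face.rel h) _) _)
  let o : Fin (Fintype.card (Quotient X)) ≃o Fin (Fintype.card (Quotient X)) :=
    ⟨e.symm.trans f, by simp [← key]⟩
  ext1 c
  have := DFunLike.congr_fun (Subsingleton.elim o (OrderIso.refl _)) (e c)
  simpa [o] using this.symm

/-- If `q` rearranges the block sizes of `X`, the blocks of `X` can be ordered with sizes `q`. -/
theorem exists_toComposition_eq {q : Composition n} (h : (q.blocks : Multiset ℕ) = X.blockSizes) :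
    ∃ e : Quotient X ≃ Fin (Fintype.card (Quotient X)), toComposition e = q := by
  have hlen : q.length = Fintype.card (Quotient X) := by
    have := congrArg Multiset.card h
    simpa [blockSizes] using this
  have hfib : ∀ m, Fintype.card {c // X.blockSize c = m} =
      Fintype.card {i // q.blocksFun (Fin.cast hlen.symm i) = m} := by
    intro m
    have hq : (q.blocks : Multiset ℕ) = Finset.univ.val.map q.blocksFun := by
      rw [Fin.univ_val_map, q.ofFn_blocksFun]
    have hcount := congrArg (Multiset.count m) h
    rw [hq, ← Multiset.map_univ_val_equiv (finCongr hlen.symm), Multiset.map_map, blockSizes,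
      Multiset.count_map, Multiset.count_map] at hcount
    rw [Fintype.card_subtype, Fintype.card_subtype]
    simp only [eq_comm (b := m)]
    exact hcount.symm
  let e := Equiv.ofFiberEquiv fun m => Fintype.equivOfCardEq (hfib m)
  refine ⟨e, Composition.ext ?_⟩
  rw [← q.ofFn_blocksFun]
  refine List.ext_get ?_ fun i h₁ h₂ => ?_
  · simp [toComposition, hlen]
  · have := Equiv.ofFiberEquiv_map (fun m => Fintype.equivOfCardEq (hfib m))
      (e.symm ⟨i, by simpa [toComposition] using h₁⟩)
    change q.blocksFun (Fin.cast _ (e _)) = _ at this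
    rw [Equiv.apply_symm_apply] at this
    simp only [toComposition, List.get_eq_getElem, List.getElem_ofFn]
    rw [← this]
    rfl

theorem toComposition_eq_iff (e f : Quotient X ≃ Fin (Fintype.card (Quotient X))) :
    toComposition f = toComposition e ↔ X.blockSize ∘ (e.trans f.symm) = X.blockSize := by
  rw [Composition.ext_iff]
  change List.ofFn _ = List.ofFn _ ↔ _
  rw [List.ofFn_inj]
  constructor
  · intro h
    ext c
    simpa using congrFun h (e c)
  · intro h
    ext i
    simpa using congrFun h (e.symm i)

/-- The number of orderings of the blocks of `X` giving a fixed composition. -/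
theorem card_toComposition_eq (e : Quotient X ≃ Fin (Fintype.card (Quotient X))) :
    (Finset.univ.filter fun f : Quotient X ≃ Fin (Fintype.card (Quotient X)) =>
      toComposition f = toComposition e).card =
      ∏ m ∈ X.blockSizes.toFinset, (X.blockSizes.count m).factorial := by
  have h1 : (Finset.univ.filter fun f : Quotient X ≃ Fin (Fintype.card (Quotient X)) =>
      toComposition f = toComposition e).card =
      Fintype.card {π : Equiv.Perm (Quotient X) // X.blockSize ∘ π = X.blockSize} := by
    rw [Fintype.card_subtype]
    refine Finset.card_bij (fun f _ => e.trans f.symm) ?_ ?_ ?_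
    · intro f hf
      simpa [toComposition_eq_iff] using hf
    · intro f _ g _ h
      have h' : f.symm = g.symm := by
        ext1 i
        simpa using DFunLike.congr_fun h (e.symm i)
      simpa using congrArg Equiv.symm h'
    · intro π hπ
      refine ⟨π.symm.trans e, ?_, ?_⟩
      · rw [Finset.mem_filter, toComposition_eq_iff]
        refine ⟨Finset.mem_univ _, ?_⟩
        rw [Finset.mem_filter] at hπ
        convert hπ.2 using 2
        ext c
        simp
      · ext c
        simp
  let w : Quotient X → {m // m ∈ X.blockSizes.toFinset} :=
    fun c => ⟨X.blockSize c, by simp [blockSizes]⟩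
  have h2 : Fintype.card {π : Equiv.Perm (Quotient X) // X.blockSize ∘ π = X.blockSize} =
      Fintype.card {π : Equiv.Perm (Quotient X) // w ∘ π = w} := by
    refine Fintype.card_congr (Equiv.subtypeEquivRight fun π => ?_)
    simp [funext_iff, w, Subtype.ext_iff]
  rw [h1, h2, DomMulAct.stabilizer_card, ← Finset.prod_coe_sort X.blockSizes.toFinset]
  refine Finset.prod_congr rfl fun m _ => ?_
  congr 1
  change _ = (Finset.univ.val.map X.blockSize).count m.1
  rw [Multiset.count_map, Fintype.card_subtype]
  simp only [w, Subtype.ext_iff, eq_comm (b := m.1)]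
  rfl

end Setoid

namespace Face

variable {n : ℕ}

/-- The underlying unordered set partition of a face. -/
def supp (r : Face n) : Setoid (Fin n) where
  r x y := r.rel x y ∧ r.rel y x
  iseqv := ⟨fun x => ⟨r.refl x, r.refl x⟩, fun h => ⟨h.2, h.1⟩,
    fun h₁ h₂ => ⟨r.trans _ _ _ h₁.1 h₂.1, r.trans _ _ _ h₂.2 h₁.2⟩⟩

theorem supp_toFace {X : Setoid (Fin n)} (e : Quotient X ≃ Fin (Fintype.card (Quotient X))) :
    (Setoid.toFace e).supp = X := by
  ext x y
  change (e ⟦x⟧ ≤ e ⟦y⟧ ∧ e ⟦y⟧ ≤ e ⟦x⟧) ↔ _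
  rw [← le_antisymm_iff, e.injective.eq_iff]
  exact Quotient.eq

theorem exists_toFace_eq (r : Face n) :
    ∃ e : Quotient r.supp ≃ Fin (Fintype.card (Quotient r.supp)), Setoid.toFace e = r := by
  let le : Quotient r.supp → Quotient r.supp → Prop := Quotient.lift₂ r.rel fun a b c d h₁ h₂ =>
    propext ⟨fun h => r.trans _ _ _ h₁.2 (r.trans _ _ _ h h₂.1),
      fun h => r.trans _ _ _ h₁.1 (r.trans _ _ _ h h₂.2)⟩
  obtain ⟨e, he⟩ := exists_equiv_fin_le_iff le (by rintro ⟨x⟩; exact r.refl x)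
    (by rintro ⟨x⟩ ⟨y⟩ ⟨z⟩; exact r.trans x y z)
    (by rintro ⟨x⟩ ⟨y⟩ h₁ h₂; exact Quotient.sound ⟨h₁, h₂⟩)
    (by rintro ⟨x⟩ ⟨y⟩; exact r.total x y)
  refine ⟨e, ?_⟩
  ext x y
  exact he _ _

theorem exists_properPartialSums_eq_type (r : Face n) :
    ∃ q : Composition n, properPartialSums q = r.type := by
  obtain ⟨e, he⟩ := r.exists_toFace_eq
  exact ⟨_, by rw [← Setoid.type_toFace e, he]⟩

/-- The composition of block sizes of a face. -/
def comp (r : Face n) : Composition n := r.exists_properPartialSums_eq_type.choose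

theorem comp_eq_iff (r : Face n) (q : Composition n) :
    r.comp = q ↔ r.type = properPartialSums q := by
  rw [← r.exists_properPartialSums_eq_type.choose_spec]
  exact (properPartialSums_injective n).eq_iff.symm

theorem comp_toFace {X : Setoid (Fin n)} (e : Quotient X ≃ Fin (Fintype.card (Quotient X))) :
    (Setoid.toFace e).comp = Setoid.toComposition e :=
  (comp_eq_iff _ _).2 (Setoid.type_toFace e)

theorem coe_blocks_comp (r : Face n) : (r.comp.blocks : Multiset ℕ) = r.supp.blockSizes := by
  obtain ⟨e, he⟩ := r.exists_toFace_eq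
  rw [← Setoid.coe_blocks_toComposition e, ← comp_toFace e, he]

theorem exists_comp_eq (q : Composition n) : ∃ r : Face n, r.comp = q :=
  ⟨std n (properPartialSums q),
    (comp_eq_iff _ _).2 (type_std q.bounds_of_mem_properPartialSums)⟩

/-- The sum of `f ∘ comp` over the orderings of a set partition `X`. -/
theorem sum_supp_eq {R : Type*} [CommSemiring R] (X : Setoid (Fin n)) (f : Composition n → R) :
    ∑ r ∈ Finset.univ.filter (fun r : Face n => r.supp = X), f r.comp =
      (∏ m ∈ X.blockSizes.toFinset, (X.blockSizes.count m).factorial : ℕ) *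
        ∑ q ∈ Finset.univ.filter (fun q : Composition n =>
          (q.blocks : Multiset ℕ) = X.blockSizes), f q := by
  have h1 : ∑ r ∈ Finset.univ.filter (fun r : Face n => r.supp = X), f r.comp =
      ∑ e : Quotient X ≃ Fin (Fintype.card (Quotient X)), f (Setoid.toComposition e) := by
    symm
    refine Finset.sum_bij (fun e _ => Setoid.toFace e) ?_ ?_ ?_ ?_
    · intro e _
      simpa using supp_toFace e
    · intro e _ e' _ h
      exact Setoid.toFace_injective h
    · intro r hr
      rw [Finset.mem_filter] at hr
      obtain ⟨-, rfl⟩ := hr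
      obtain ⟨e, he⟩ := r.exists_toFace_eq
      exact ⟨e, Finset.mem_univ _, he⟩
    · intro e _
      rw [comp_toFace]
  rw [h1, ← Finset.sum_fiberwise_of_maps_to (g := Setoid.toComposition)
    (t := Finset.univ.filter (fun q : Composition n => (q.blocks : Multiset ℕ) = X.blockSizes)),
    Finset.mul_sum]
  · refine Finset.sum_congr rfl fun q hq => ?_
    rw [Finset.mem_filter] at hq
    obtain ⟨e, rfl⟩ := Setoid.exists_toComposition_eq hq.2
    rw [← Setoid.card_toComposition_eq e, ← nsmul_eq_mul]
    refine Finset.sum_eq_card_nsmul fun f' hf' => ?_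
    rw [Finset.mem_filter] at hf'
    rw [hf'.2]
  · intro e _
    rw [Finset.mem_filter]
    exact ⟨Finset.mem_univ _, Setoid.coe_blocks_toComposition e⟩

end Face

/-- Set partitions of `{1,…,n}` under common refinement. -/
def SetPartition (n : ℕ) : Type := Setoid (Fin n)

namespace SetPartition

variable {n : ℕ}

instance : Fintype (SetPartition n) :=
  Fintype.ofInjective (fun X : Setoid (Fin n) => X.r) fun _ _ h => Setoid.ext fun x y =>
    iff_of_eq (congrFun (congrFun h x) y)

instance : PartialOrder (SetPartition n) := inferInstanceAs (PartialOrder (Setoid (Fin n)))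

instance : CommMonoid (SetPartition n) where
  mul a b := (a ⊓ b : Setoid (Fin n))
  one := (⊤ : Setoid (Fin n))
  mul_assoc a b c := inf_assoc (α := Setoid (Fin n)) a b c
  one_mul a := top_inf_eq (α := Setoid (Fin n)) a
  mul_one a := inf_top_eq (α := Setoid (Fin n)) a
  mul_comm a b := inf_comm (α := Setoid (Fin n)) a b

theorem mul_self (a : SetPartition n) : a * a = a := inf_idem (α := Setoid (Fin n)) a

theorem pow_eq_self (a : SetPartition n) : ∀ {m : ℕ}, m ≠ 0 → a ^ m = a
  | 1, _ => pow_one a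
  | m + 2, _ => by rw [pow_succ, pow_eq_self a m.succ_ne_zero, mul_self]

end SetPartition

namespace MonoidAlgebra

variable {R M N : Type*} [CommSemiring R]

theorem coeff_mapDomain_eq_sum [Fintype M] (f : M → N) (z : MonoidAlgebra R M) (b : N) :
    (mapDomain f z).coeff b = ∑ a ∈ Finset.univ.filter (fun a => f a = b), z.coeff a := by
  induction z using MonoidAlgebra.induction_linear with
  | zero => simp
  | add x y hx hy => rw [mapDomain_add, coeff_add, Finsupp.add_apply, hx, hy]; simp [Finset.sum_add_distrib]
  | single m r =>
    simp [Finsupp.single_apply]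

theorem sum_single_coeff [Fintype M] (z : MonoidAlgebra R M) :
    ∑ a, single a (z.coeff a) = z := by
  induction z using MonoidAlgebra.induction_linear with
  | zero => simp
  | add x y hx hy => simp [Finset.sum_add_distrib, hx, hy]
  | single m r =>
    rw [Finset.sum_eq_single m]
    · simp
    · intro b _ hb
      simp [hb.symm]
    · simp

end MonoidAlgebra

open MonoidAlgebra in
theorem SetPartition.monoidAlgebra_pow_eq_self {n p : ℕ} [Fact p.Prime]
    (z : MonoidAlgebra (ZMod p) (SetPartition n)) : z ^ p = z := by
  have : CharP (MonoidAlgebra (ZMod p) (SetPartition n)) p := charP_of_injective_algebraMap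
    (algebraMap (ZMod p) (MonoidAlgebra (ZMod p) (SetPartition n))).injective p
  induction z using MonoidAlgebra.induction_linear with
  | zero => exact zero_pow (Fact.out : p.Prime).ne_zero
  | add x y hx hy => rw [add_pow_char, hx, hy]
  | single X a =>
    rw [single_pow, ZMod.pow_card, X.pow_eq_self (Fact.out : p.Prime).ne_zero]

namespace Face

open MonoidAlgebra

variable {n : ℕ}

/-- The support map from faces to set partitions, as a monoid homomorphism. -/
def suppHom (n : ℕ) : Face n →* SetPartition n where
  toFun := supp
  map_one' := Setoid.ext fun _ _ => ⟨fun _ => trivial, fun _ => ⟨trivial, trivial⟩⟩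
  map_mul' a b := by
    refine Setoid.ext fun x y => ?_
    change ((_ ∧ (_ → _)) ∧ (_ ∧ (_ → _))) ↔ ((_ ∧ _) ∧ (_ ∧ _))
    tauto

theorem mul_eq_right {r h : Face n} (hrh : suppHom n h ≤ suppHom n r) : r * h = h := by
  ext x y
  rw [mul_rel]
  exact ⟨fun hxy => hxy.1, fun hxy => ⟨hxy, fun hyx => (hrh (x := x) (y := y) ⟨hxy, hyx⟩).1⟩⟩

theorem suppHom_mul_lt {r h : Face n} (hrh : ¬ suppHom n h ≤ suppHom n r) :
    suppHom n (r * h) < suppHom n h := by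
  rw [map_mul]
  exact inf_lt_right (α := Setoid (Fin n)).2 hrh

variable {R : Type*} [CommRing R]

theorem sum_coeff_eq_zero {z : MonoidAlgebra R (Face n)}
    (hz : mapDomainRingHom R (suppHom n) z = 0) (X : SetPartition n) :
    ∑ r ∈ Finset.univ.filter (fun r : Face n => X ≤ suppHom n r), z.coeff r = 0 := by
  rw [← Finset.sum_fiberwise_of_maps_to (g := suppHom n)
    (t := Finset.univ.filter (fun Y : SetPartition n => X ≤ Y)) (by simp)]
  refine Finset.sum_eq_zero fun Y hY => ?_
  have h := coeff_mapDomain_eq_sum (suppHom n) z Y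
  have h0 : mapDomain (suppHom n) z = 0 := hz
  rw [h0] at h
  rw [Finset.filter_filter]
  refine Eq.trans (Finset.sum_congr (Finset.filter_congr fun r _ => ?_) fun _ _ => rfl) h.symm
  rw [Finset.mem_filter] at hY
  exact ⟨fun h => h.2, fun h => ⟨h ▸ hY.2, h⟩⟩

/-- Elements of the face algebra killed by the support map are nilpotent. -/
theorem exists_pow_mul_single_eq_zero {z : MonoidAlgebra R (Face n)}
    (hz : mapDomainRingHom R (suppHom n) z = 0) (h : Face n) :
    ∃ N : ℕ, ∀ a : R, z ^ N * single h a = 0 := by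
  induction hX : suppHom n h using (Finite.to_wellFoundedLT (α := SetPartition n)).induction
    generalizing h with
  | _ X ih =>
  subst hX
  choose! N hN using fun (g : Face n) (hg : suppHom n g < suppHom n h) => ih _ hg g rfl
  refine ⟨Finset.univ.sup N + 1, fun a => ?_⟩
  have hstep : z * single h a = ∑ r ∈ Finset.univ.filter
      (fun r : Face n => ¬ suppHom n h ≤ suppHom n r), single (r * h) (z.coeff r * a) := by
    conv_lhs => rw [← sum_single_coeff z, Finset.sum_mul]
    simp only [single_mul_single]
    rw [← Finset.sum_filter_add_sum_filter_not _ fun r => suppHom n h ≤ suppHom n r]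
    convert zero_add _
    calc _ = ∑ r ∈ Finset.univ.filter (fun r : Face n => suppHom n h ≤ suppHom n r),
          single h (z.coeff r * a) := Finset.sum_congr rfl fun r hr => by
            rw [Finset.mem_filter] at hr
            rw [mul_eq_right hr.2]
      _ = _ := by
        refine Eq.trans (map_sum (singleAddHom h) _ _).symm ?_
        rw [← Finset.sum_mul, sum_coeff_eq_zero hz, zero_mul, map_zero]
  rw [pow_succ, mul_assoc, hstep, Finset.mul_sum]
  refine Finset.sum_eq_zero fun r hr => ?_
  rw [Finset.mem_filter] at hr
  have hle : N (r * h) ≤ Finset.univ.sup N := Finset.le_sup (f := N) (Finset.mem_univ _)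
  rw [← Nat.sub_add_cancel hle, pow_add, mul_assoc, hN _ (suppHom_mul_lt hr.2), mul_zero]

theorem isNilpotent_of_mapDomain_suppHom_eq_zero {z : MonoidAlgebra R (Face n)}
    (hz : mapDomainRingHom R (suppHom n) z = 0) : IsNilpotent z := by
  obtain ⟨N, hN⟩ := exists_pow_mul_single_eq_zero hz 1
  exact ⟨N, by rw [← hN 1, ← one_def, mul_one]⟩

end Face

/-- If `φ` has nil kernel and values in a commutative ring where `z ^ p = z`, its kernel is the
Jacobson radical. -/
theorem RingHom.mem_jacobson_bot_iff_of_pow_eq_self {A C : Type*} [Ring A] [CommRing C]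
    (φ : A →+* C) {p : ℕ} (hp : 2 ≤ p) (hC : ∀ z : C, z ^ p = z)
    (hnil : ∀ a, φ a = 0 → IsNilpotent a) (a : A) :
    a ∈ (⊥ : Ideal A).jacobson ↔ φ a = 0 := by
  obtain ⟨m, rfl⟩ := Nat.exists_eq_add_of_le' hp
  rw [Ideal.mem_jacobson_iff]
  constructor
  · intro h
    obtain ⟨z, hz⟩ := h (-a ^ m)
    have h1 := congrArg φ ((Submodule.mem_bot A).1 hz)
    simp only [map_sub, map_add, map_mul, map_neg, map_pow, map_one, map_zero] at h1
    have h2 := hC (φ a)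
    rw [pow_add] at h2
    linear_combination -φ a * h1 - φ z * h2
  · intro h y
    have hn : IsNilpotent (y * a) := hnil _ (by rw [map_mul, h, mul_zero])
    obtain ⟨u, hu⟩ := hn.isUnit_add_one
    refine ⟨↑u⁻¹, ?_⟩
    rw [Submodule.mem_bot, mul_assoc]
    have := u.inv_mul
    rw [hu] at this
    rw [mul_add, mul_one] at this
    rw [this, sub_self]

namespace Face

open MonoidAlgebra

variable {n : ℕ} {R : Type*} [CommRing R]

/-- The action of a permutation on faces, as a monoid homomorphism. -/
def smulHom (σ : Equiv.Perm (Fin n)) : Face n →* Face n where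
  toFun r := σ • r
  map_one' := smul_one' σ
  map_mul' := smul_mul' σ

variable (n R) in
/-- The elements of the face algebra fixed by all permutations. -/
def invariants : Subalgebra R (MonoidAlgebra R (Face n)) :=
  ⨅ σ : Equiv.Perm (Fin n), AlgHom.equalizer (mapDomainAlgHom R R (smulHom σ)) (AlgHom.id R _)

theorem mem_invariants {x : MonoidAlgebra R (Face n)} :
    x ∈ invariants n R ↔ ∀ σ : Equiv.Perm (Fin n), mapDomain (σ • ·) x = x :=
  Algebra.mem_iInf

theorem coeff_smul {x : MonoidAlgebra R (Face n)} (hx : x ∈ invariants n R)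
    (σ : Equiv.Perm (Fin n)) (r : Face n) : x.coeff (σ • r) = x.coeff r := by
  conv_lhs => rw [← mem_invariants.1 hx σ]
  exact Finsupp.mapDomain_apply (MulAction.injective σ) _ _

theorem comp_smul (σ : Equiv.Perm (Fin n)) (r : Face n) : (σ • r).comp = r.comp := by
  rw [comp_eq_iff, type_smul, ← comp_eq_iff]

theorem exists_smul_eq_of_comp_eq {r s : Face n} (h : r.comp = s.comp) :
    ∃ σ : Equiv.Perm (Fin n), s = σ • r := by
  have ht : r.type = s.type := by
    rw [(comp_eq_iff r _).1 h, (comp_eq_iff s _).1 rfl]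
  refine ⟨s.word * r.word⁻¹, s.eq_word_smul_std.trans ?_⟩
  rw [mul_smul, ← ht]
  exact congrArg (s.word • ·) (eq_inv_smul_iff.2 r.eq_word_smul_std.symm)

theorem word_one : (1 : Face n).word = 1 :=
  word_eq _ _ fun _ _ h => h.2 trivial

variable (n R) in
/-- The linear extension of `word` to the face algebra. -/
def wordLin : MonoidAlgebra R (Face n) →ₗ[R] MonoidAlgebra R (Equiv.Perm (Fin n)) :=
  mapDomainLinearMap R R word

theorem wordLin_single (r : Face n) (a : R) : wordLin n R (single r a) = single r.word a :=
  mapDomainLinearMap_single _ _ _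

theorem wordLin_single_mul (s : Face n) (a : R) (x : MonoidAlgebra R (Face n)) :
    wordLin n R (single s a * x) =
      single s.word a * wordLin n R (mapDomain (s.word⁻¹ • ·) x) := by
  induction x using MonoidAlgebra.induction_linear with
  | zero => simp
  | add x y hx hy => simp only [mul_add, map_add, mapDomain_add, hx, hy]
  | single r b =>
    rw [single_mul_single, wordLin_single, mapDomain_single, wordLin_single, single_mul_single,
      word_mul]

theorem wordLin_mul (y : MonoidAlgebra R (Face n)) {x : MonoidAlgebra R (Face n)}
    (hx : x ∈ invariants n R) : wordLin n R (y * x) = wordLin n R y * wordLin n R x := by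
  induction y using MonoidAlgebra.induction_linear with
  | zero => simp
  | add y z hy hz => simp only [add_mul, map_add, hy, hz]
  | single s a => rw [wordLin_single_mul, mem_invariants.1 hx, wordLin_single]

variable (n R) in
/-- On invariants, `word` induces an algebra homomorphism. -/
def wordHom : invariants n R →ₐ[R] MonoidAlgebra R (Equiv.Perm (Fin n)) :=
  AlgHom.ofLinearMap ((wordLin n R).comp (invariants n R).val.toLinearMap)
    (by
      change wordLin n R (single 1 1) = single 1 1
      rw [wordLin_single, word_one])
    (fun x y => wordLin_mul x.1 y.2)

/-- The invariant with given coefficients on each type of face. -/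
def ofCoeffs (c : Composition n → R) : invariants n R :=
  ⟨∑ r : Face n, single r (c r.comp), mem_invariants.2 fun σ => by
    change mapDomainLinearMap R R (σ • ·) _ = _
    rw [map_sum]
    simp only [mapDomainLinearMap_single]
    refine Fintype.sum_equiv (MulAction.toPerm σ) _ _ fun r => ?_
    simp [comp_smul]⟩

theorem ofCoeffs_surjective : Function.Surjective (ofCoeffs : (Composition n → R) → _) := by
  intro x
  choose f hf using exists_comp_eq (n := n)
  refine ⟨fun q => x.1.coeff (f q), Subtype.ext ?_⟩
  change ∑ r : Face n, single r (x.1.coeff (f r.comp)) = x.1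
  conv_rhs => rw [← sum_single_coeff x.1]
  refine Finset.sum_congr rfl fun r _ => ?_
  obtain ⟨σ, hσ⟩ := exists_smul_eq_of_comp_eq (hf r.comp)
  conv_rhs => rw [hσ, coeff_smul x.2]
  rw [← hσ]

theorem coeff_ofCoeffs (c : Composition n → R) (r : Face n) :
    (ofCoeffs c).1.coeff r = c r.comp := by
  change (∑ r : Face n, single r (c r.comp)).coeff r = _
  simp [Finsupp.single_apply]

theorem coeff_mapDomain_suppHom_ofCoeffs (c : Composition n → R) (X : SetPartition n) :
    (mapDomainRingHom R (suppHom n) (ofCoeffs c).1).coeff X =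
      (∏ m ∈ (Setoid.blockSizes X).toFinset, ((Setoid.blockSizes X).count m).factorial : ℕ) *
        ∑ q ∈ Finset.univ.filter (fun q : Composition n =>
          (q.blocks : Multiset ℕ) = Setoid.blockSizes X), c q := by
  refine (coeff_mapDomain_eq_sum _ _ _).trans (Eq.trans ?_ (sum_supp_eq (X : Setoid (Fin n)) c))
  simp only [coeff_ofCoeffs]
  rfl

theorem wordHom_ofCoeffs {p : ℕ} (c : Composition n → ZMod p) :
    wordHom n (ZMod p) (ofCoeffs c) = Fintype.linearCombination (ZMod p) (Bel n p) c := by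
  change wordLin n (ZMod p) (∑ r : Face n, single r (c r.comp)) = _
  rw [map_sum, Fintype.linearCombination_apply, ← Finset.sum_fiberwise (g := comp)]
  refine Finset.sum_congr rfl fun q _ => ?_
  rw [Bel, ← sum_type_eq q.bounds_of_mem_properPartialSums, Finset.smul_sum]
  refine Finset.sum_congr (Finset.filter_congr fun r _ => comp_eq_iff r q) fun r hr => ?_
  rw [Finset.mem_filter, ← comp_eq_iff] at hr
  rw [wordLin_single, hr.2, of_apply, smul_single, smul_eq_mul, mul_one]

end Face

theorem linearIndependent_Bel (n p : ℕ) [Fact p.Prime] : LinearIndependent (ZMod p) (Bel n p) := by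
  rw [Fintype.linearIndependent_iff]
  intro c hc
  by_contra! hne
  obtain ⟨q, hq, hmax⟩ := Set.Finite.exists_maximalFor (properPartialSums : Composition n → Set ℕ)
    {q | c q ≠ 0} (Set.toFinite _) hne
  obtain ⟨σ, hσ⟩ := Face.exists_descSet_eq q.bounds_of_mem_properPartialSums
  refine hq ?_
  have h := congrArg (fun x : GroupAlg n p => x.coeff σ) hc
  have hB : ∀ r, (Bel n p r).coeff σ = if descSet σ ⊆ properPartialSums r then 1 else 0 := by
    intro r
    simp [Bel, Finsupp.single_apply]
  simp only [MonoidAlgebra.coeff_sum, MonoidAlgebra.coeff_smul, Finsupp.finsetSum_apply,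
    Finsupp.smul_apply, hB] at h
  rw [Finset.sum_eq_single q] at h
  · simpa [hσ] using h
  · intro r _ hr
    rw [hσ]
    split_ifs with hsub
    · by_cases hr0 : c r = 0
      · simp [hr0]
      · exact absurd (properPartialSums_injective n ((hmax hr0 hsub).antisymm hsub)) hr
    · simp
  · simp

section DescentAlgebra

open Nat.Partition

variable {n p : ℕ}

theorem linearCombination_single_one (q : Composition n) :
    Fintype.linearCombination (ZMod p) (Bel n p) (Pi.single q 1) = Bel n p q := by
  rw [Fintype.linearCombination_apply_single, one_smul]

/-- The sums of coefficients over the rearrangement classes whose multiplicities are all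
less than `p`. -/
def classSum (n p : ℕ) : (Composition n → ZMod p) →ₗ[ZMod p] (countRestricted n p → ZMod p) :=
  LinearMap.pi fun μ => ∑ q ∈ Finset.univ.filter (fun q => ofComposition n q = μ), LinearMap.proj q

theorem classSum_apply (c : Composition n → ZMod p) (μ : countRestricted n p) :
    classSum n p c μ = ∑ q ∈ Finset.univ.filter (fun q => ofComposition n q = μ), c q := by
  simp [classSum]

theorem classSum_single (q : Composition n) (μ : countRestricted n p) :
    classSum n p (Pi.single q 1) μ = if ofComposition n q = μ then 1 else 0 := by
  rw [classSum_apply, Finset.sum_pi_single']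
  simp

theorem count_parts_ofComposition (q : Composition n) (i : ℕ) :
    (ofComposition n q).parts.count i = q.blocks.count i :=
  Multiset.coe_count _ _

theorem ofComposition_eq_iff {q r : Composition n} :
    ofComposition n q = ofComposition n r ↔ q.blocks.Perm r.blocks := by
  rw [Nat.Partition.ext_iff]
  exact Multiset.coe_eq_coe

theorem range_wordHom : (Face.wordHom n (ZMod p)).range = descentAlgebra n p := by
  apply le_antisymm
  · rintro _ ⟨x, rfl⟩
    obtain ⟨c, rfl⟩ := Face.ofCoeffs_surjective x
    change Face.wordHom n (ZMod p) (Face.ofCoeffs c) ∈ _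
    rw [Face.wordHom_ofCoeffs, Fintype.linearCombination_apply]
    exact sum_mem fun q _ => Subalgebra.smul_mem _ (Algebra.subset_adjoin (Set.mem_range_self q)) _
  · refine Algebra.adjoin_le ?_
    rintro _ ⟨q, rfl⟩
    rw [← linearCombination_single_one, ← Face.wordHom_ofCoeffs]
    exact ⟨_, rfl⟩

variable [Fact p.Prime]

theorem classSum_surjective : Function.Surjective (classSum n p) := by
  intro d
  choose s hs using ofComposition_surj (n := n)
  refine ⟨∑ μ : countRestricted n p, d μ • Pi.single (s μ) 1, ?_⟩
  ext ν
  simp only [map_sum, map_smul, Finset.sum_apply, Pi.smul_apply, classSum_single, hs, smul_eq_mul]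
  rw [Finset.sum_eq_single ν]
  · simp
  · intro μ _ hμ
    simp [Subtype.coe_ne_coe.2 hμ]
  · simp

theorem wordHom_injective : Function.Injective (Face.wordHom n (ZMod p)) := by
  intro x y h
  obtain ⟨c, rfl⟩ := Face.ofCoeffs_surjective x
  obtain ⟨d, rfl⟩ := Face.ofCoeffs_surjective y
  rw [Face.wordHom_ofCoeffs, Face.wordHom_ofCoeffs] at h
  rw [(linearIndependent_Bel n p).fintypeLinearCombination_injective h]

variable (n p) in
/-- The descent algebra as the algebra of invariant elements of the face algebra. -/
def invariantsEquiv : Face.invariants n (ZMod p) ≃ₐ[ZMod p] descentAlgebra n p :=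
  (AlgEquiv.ofInjective _ wordHom_injective).trans (Subalgebra.equivOfEq _ _ range_wordHom)

theorem coe_invariantsEquiv (c : Composition n → ZMod p) :
    (invariantsEquiv n p (Face.ofCoeffs c) : GroupAlg n p) =
      Fintype.linearCombination (ZMod p) (Bel n p) c :=
  Face.wordHom_ofCoeffs c

theorem mem_descentRadical_iff (a : descentAlgebra n p) :
    a ∈ descentRadical n p ↔ MonoidAlgebra.mapDomainRingHom (ZMod p) (Face.suppHom n)
      ((invariantsEquiv n p).symm a).1 = 0 := by
  refine RingHom.mem_jacobson_bot_iff_of_pow_eq_self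
    ((MonoidAlgebra.mapDomainRingHom (ZMod p) (Face.suppHom n)).comp
      ((Face.invariants n (ZMod p)).val.toRingHom.comp
        (invariantsEquiv n p).symm.toAlgHom.toRingHom))
    (Fact.out : p.Prime).two_le SetPartition.monoidAlgebra_pow_eq_self (fun a ha => ?_) a
  obtain ⟨N, hN⟩ := Face.isNilpotent_of_mapDomain_suppHom_eq_zero ha
  refine ⟨N, (invariantsEquiv n p).symm.injective (Subtype.ext ?_)⟩
  rw [map_pow, map_zero]
  exact hN

theorem cast_prod_factorial_count_eq_zero_iff (s : Multiset ℕ) :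
    ((∏ m ∈ s.toFinset, (s.count m).factorial : ℕ) : ZMod p) = 0 ↔ ∃ m ∈ s, p ≤ s.count m := by
  have hp : p.Prime := Fact.out
  rw [ZMod.natCast_eq_zero_iff, hp.prime.dvd_finsetProd_iff]
  simp [hp.dvd_factorial]

theorem linearCombination_mem_descentRadicalSubmodule_iff (c : Composition n → ZMod p) :
    Fintype.linearCombination (ZMod p) (Bel n p) c ∈ descentRadicalSubmodule n p ↔
      c ∈ LinearMap.ker (classSum n p) := by
  have h1 : Fintype.linearCombination (ZMod p) (Bel n p) c ∈ descentRadicalSubmodule n p ↔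
      invariantsEquiv n p (Face.ofCoeffs c) ∈ descentRadical n p := by
    rw [← coe_invariantsEquiv]
    constructor
    · rintro ⟨a, ha, hac⟩
      rwa [Subtype.ext (show (a : GroupAlg n p) = _ from hac)] at ha
    · intro h
      exact ⟨_, h, rfl⟩
  rw [h1, mem_descentRadical_iff, AlgEquiv.symm_apply_apply, LinearMap.mem_ker]
  constructor
  · intro h
    ext μ
    obtain ⟨q, hq⟩ := ofComposition_surj μ.1
    obtain ⟨r, rfl⟩ := Face.exists_comp_eq q
    have h2 := Face.coeff_mapDomain_suppHom_ofCoeffs c r.supp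
    rw [h] at h2
    have hμ : μ.1.parts = Setoid.blockSizes r.supp := by
      rw [← hq, ← Face.coe_blocks_comp]
      rfl
    rw [← hμ] at h2
    rw [classSum_apply]
    refine Eq.trans (Finset.sum_congr (Finset.filter_congr fun q _ => Nat.Partition.ext_iff)
      fun _ _ => rfl) ((mul_eq_zero.1 h2.symm).resolve_left fun h0 => ?_)
    obtain ⟨m, hm, hpm⟩ := (cast_prod_factorial_count_eq_zero_iff _).1 h0
    have := (Finset.mem_filter.1 μ.2).2 m hm
    omega
  · intro h
    ext X
    rw [Face.coeff_mapDomain_suppHom_ofCoeffs]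
    obtain ⟨r, rfl⟩ : ∃ r : Face n, r.supp = X :=
      let Y : Setoid (Fin n) := X
      ⟨Setoid.toFace (Fintype.equivFin (Quotient Y)), Face.supp_toFace _⟩
    rw [← Face.coe_blocks_comp]
    refine mul_eq_zero.2 (or_iff_not_imp_left.2 fun h0 => ?_)
    rw [cast_prod_factorial_count_eq_zero_iff] at h0
    push Not at h0
    have h2 := congrFun h ⟨ofComposition n r.comp,
      Finset.mem_filter.2 ⟨Finset.mem_univ _, h0⟩⟩
    rw [classSum_apply] at h2
    exact (Finset.sum_congr (Finset.filter_congr fun q _ => Nat.Partition.ext_iff.symm)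
      fun _ _ => rfl).trans h2

theorem descentRadicalSubmodule_eq_map : descentRadicalSubmodule n p =
    (LinearMap.ker (classSum n p)).map (Fintype.linearCombination (ZMod p) (Bel n p)) := by
  ext x
  constructor
  · intro hx
    obtain ⟨a, -, rfl⟩ := id hx
    obtain ⟨y, rfl⟩ := (invariantsEquiv n p).surjective a
    obtain ⟨c, rfl⟩ := Face.ofCoeffs_surjective y
    have hc : (descentAlgebra n p).val.toLinearMap (invariantsEquiv n p (Face.ofCoeffs c)) =
      Fintype.linearCombination (ZMod p) (Bel n p) c := coe_invariantsEquiv c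
    rw [hc] at hx ⊢
    exact Submodule.mem_map_of_mem ((linearCombination_mem_descentRadicalSubmodule_iff c).1 hx)
  · rintro ⟨c, hc, rfl⟩
    exact (linearCombination_mem_descentRadicalSubmodule_iff c).2 hc

theorem finrank_descentRadicalSubmodule :
    Module.finrank (ZMod p) (descentRadicalSubmodule n p) = 2 ^ (n - 1) - gPart n p := by
  have hinj := (linearIndependent_Bel n p).fintypeLinearCombination_injective
  have hrank := (classSum n p).finrank_range_add_finrank_ker
  rw [LinearMap.range_eq_top.2 classSum_surjective, finrank_top, Module.finrank_fintype_fun_eq_card,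
    Module.finrank_fintype_fun_eq_card, composition_card, Fintype.card_coe,
    ← card_restricted_eq_card_countRestricted n (Fact.out : p.Prime).pos] at hrank
  have hg : gPart n p = (restricted n (¬ p ∣ ·)).card := by
    rw [gPart, ← Set.ncard_coe_finset]
    congr 1
    ext μ
    simp [restricted]
  rw [descentRadicalSubmodule_eq_map,
    ← (Submodule.equivMapOfInjective _ hinj (LinearMap.ker (classSum n p))).finrank_eq, hg]
  omega

theorem descentRadicalSubmodule_eq_span : descentRadicalSubmodule n p =
    Submodule.span (ZMod p)
      ({x | ∃ q r : Composition n, q.blocks.Perm r.blocks ∧ x = Bel n p q - Bel n p r} ∪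
       {x | ∃ q : Composition n, (∃ i : ℕ, p ≤ q.blocks.count i) ∧ x = Bel n p q}) := by
  have hp : p.Prime := Fact.out
  apply le_antisymm
  · rw [descentRadicalSubmodule_eq_map]
    rintro _ ⟨c, hc, rfl⟩
    choose s hs using ofComposition_surj (n := n)
    rw [← sub_add_cancel (Fintype.linearCombination (ZMod p) (Bel n p) c)
      (∑ q, c q • Bel n p (s (ofComposition n q)))]
    refine add_mem ?_ ?_
    · rw [Fintype.linearCombination_apply, ← Finset.sum_sub_distrib]
      refine sum_mem fun q _ => ?_
      rw [← smul_sub]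
      exact Submodule.smul_mem _ _ (Submodule.subset_span
        (Or.inl ⟨_, _, ofComposition_eq_iff.1 (hs _).symm, rfl⟩))
    · rw [← Finset.sum_fiberwise (g := ofComposition n)]
      refine sum_mem fun μ _ => ?_
      have hμ : ∑ q ∈ Finset.univ.filter (fun q => ofComposition n q = μ),
          c q • Bel n p (s (ofComposition n q)) =
          (∑ q ∈ Finset.univ.filter (fun q => ofComposition n q = μ), c q) • Bel n p (s μ) := by
        rw [Finset.sum_smul]
        refine Finset.sum_congr rfl fun q hq => ?_
        rw [(Finset.mem_filter.1 hq).2]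
      rw [hμ]
      by_cases hr : μ ∈ countRestricted n p
      · rw [← classSum_apply c ⟨μ, hr⟩, LinearMap.mem_ker.1 hc]
        simp
      · refine Submodule.smul_mem _ _ (Submodule.subset_span (Or.inr ⟨_, ?_, rfl⟩))
        simp only [countRestricted, Finset.mem_filter, Finset.mem_univ, true_and] at hr
        push Not at hr
        obtain ⟨i, -, hi⟩ := hr
        refine ⟨i, ?_⟩
        rwa [← hs μ, count_parts_ofComposition] at hi
  · rw [Submodule.span_le]
    rintro _ (⟨q, r, hqr, rfl⟩ | ⟨q, ⟨i, hi⟩, rfl⟩)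
    · rw [← linearCombination_single_one q, ← linearCombination_single_one r, ← map_sub]
      refine (linearCombination_mem_descentRadicalSubmodule_iff _).2 (LinearMap.mem_ker.2 ?_)
      ext μ
      rw [map_sub, Pi.sub_apply, classSum_single, classSum_single, ofComposition_eq_iff.2 hqr,
        sub_self, Pi.zero_apply]
    · rw [← linearCombination_single_one q]
      refine (linearCombination_mem_descentRadicalSubmodule_iff _).2 (LinearMap.mem_ker.2 ?_)
      ext μ
      rw [classSum_single, if_neg, Pi.zero_apply]
      intro h
      have hlt := (Finset.mem_filter.1 μ.2).2
      rw [← h] at hlt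
      refine (hlt i ?_).not_ge (hi.trans_eq (count_parts_ofComposition q i).symm)
      exact List.count_pos_iff.1 (hp.pos.trans_le hi)

end DescentAlgebra

/-- `R(n,p)` is spanned by all differences `B̄_q - B̄_r` with `q ≈ r`
together with all `B̄_q` for which some component of `q` has multiplicity `p` or more;
consequently `dim_{F_p} R(n,p) = 2^{n-1} - g(n,p)`. -/
theorem stmt10 (n p : ℕ) (hn : 1 ≤ n) (hp : p.Prime) :
    descentRadicalSubmodule n p =
      Submodule.span (ZMod p)
        ({x | ∃ q r : Composition n, q.blocks.Perm r.blocks ∧ x = Bel n p q - Bel n p r} ∪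
         {x | ∃ q : Composition n, (∃ i : ℕ, p ≤ q.blocks.count i) ∧ x = Bel n p q}) ∧
    Module.finrank (ZMod p) (descentRadicalSubmodule n p) = 2 ^ (n - 1) - gPart n p := by
  have : Fact p.Prime := ⟨hp⟩
  exact ⟨descentRadicalSubmodule_eq_span, finrank_descentRadicalSubmodule⟩

end
end

section
/- For each partition π of n, fix σ_π ∈ S_n of cycle type π and define λ_π : Σ(n,p) → F_p by λ_π(x) = φ(x)(σ_π). Then each λ_π is a homomorphism of F_p-algebras (a 1-dimensional representation of Σ(n,p)); the λ_π for π ranging over the p-regular partitions of n are pairwise distinct; and every irreducible representation of Σ(n,p) is 1-dimensional and equivalent to λ_π for some p-regular partition π, so that Σ(n,p) has exactly g(n,p) irreducible representations up to equivalence. -/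
open scoped Classical

set_option synthInstance.maxHeartbeats 1000000
set_option maxHeartbeats 1000000

noncomputable section

open PowerSeries in
/-- The logarithmic derivative of `∏ i ∈ s, (1 + X ^ i)`, multiplied by `X`. -/
def logDerivSeries (K : Type) [Field K] (s : Multiset ℕ) : PowerSeries K :=
  (s.map fun i : ℕ => (C (i : K) * (X ^ i * (1 + X ^ i)⁻¹) : PowerSeries K)).sum

open PowerSeries in
lemma X_mul_derivative_prod_one_add {K : Type} [Field K] (s : Multiset ℕ) (hs : 0 ∉ s) :
    X * d⁄dX K (s.map fun i => (1 + X ^ i : PowerSeries K)).prod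
      = (s.map fun i => (1 + X ^ i : PowerSeries K)).prod * logDerivSeries K s := by
  induction s using Multiset.induction with
  | empty => simp [logDerivSeries]
  | cons a s ih =>
    simp only [Multiset.mem_cons, not_or] at hs
    have ih := ih hs.2
    have ha : a ≠ 0 := fun h => hs.1 h.symm
    simp only [logDerivSeries, Multiset.map_cons, Multiset.prod_cons, Multiset.sum_cons,
      Derivation.leibniz, smul_eq_mul, map_add, Derivation.leibniz_pow] at ih ⊢
    have hu : (1 + X ^ a : PowerSeries K) * (1 + X ^ a)⁻¹ = 1 :=
      PowerSeries.mul_inv_cancel _ (by simp [ha])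
    have h1 : d⁄dX K (1 : PowerSeries K) = 0 := by simp
    have hX : d⁄dX K (X : PowerSeries K) = 1 := by simp
    have hp : (X : PowerSeries K) * X ^ (a - 1) = X ^ a := by
      rw [← pow_succ', Nat.sub_add_cancel (Nat.pos_of_ne_zero ha)]
    have hC : (C (a : K) : PowerSeries K) = (a : PowerSeries K) := by simp
    rw [h1, hX, hC, nsmul_eq_mul]
    linear_combination (1 + X ^ a : PowerSeries K) * ih + (Multiset.map (fun i ↦ 1 + X ^ i) s).prod *
      (a * hp) - (Multiset.map (fun i ↦ (1 + X ^ i : PowerSeries K)) s).prod * (a * X ^ a) * hu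

open PowerSeries in
lemma count_cast_eq_of_logDerivSeries_eq {K : Type} [Field K] (s t : Multiset ℕ)
    (hs : ∀ i ∈ s, (i : K) ≠ 0) (ht : ∀ i ∈ t, (i : K) ≠ 0)
    (h : logDerivSeries K s = logDerivSeries K t) (j : ℕ) :
    (s.count j : K) = (t.count j : K) := by
  induction j using Nat.strong_induction_on with
  | _ j ih =>
    by_cases hj : (j : K) = 0
    · rw [Multiset.count_eq_zero.2 fun h => hs j h hj, Multiset.count_eq_zero.2 fun h => ht j h hj]
    have hj0 : j ≠ 0 := by rintro rfl; simp at hj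
    have expand : ∀ r : Multiset ℕ, r ⊆ s + t → logDerivSeries K r =
        ∑ i ∈ (s + t).toFinset, r.count i • (C (i : K) * (X ^ i * (1 + X ^ i)⁻¹) : PowerSeries K) := by
      intro r hr
      rw [logDerivSeries, Finset.sum_multiset_map_count]
      refine Finset.sum_subset (fun i hi => ?_) fun i _ hi => ?_
      · exact Multiset.mem_toFinset.2 (hr (Multiset.mem_toFinset.1 hi))
      · rw [Multiset.count_eq_zero.2 (by simpa using hi), zero_smul]
    rw [expand s (fun i hi => Multiset.mem_add.2 (Or.inl hi)),
      expand t (fun i hi => Multiset.mem_add.2 (Or.inr hi))] at h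
    have h := congrArg (coeff j) h
    simp only [map_sum, nsmul_eq_mul] at h
    rw [← sub_eq_zero, ← Finset.sum_sub_distrib, Finset.sum_eq_single j] at h
    · rw [← map_natCast (C (R := K)), ← map_natCast (C (R := K)), coeff_C_mul, coeff_C_mul,
        coeff_C_mul, coeff_C_mul, coeff_X_pow_mul'] at h
      rw [← sub_mul] at h
      simp [hj0, hj, sub_eq_zero] at h
      exact h
    · intro i _ hij
      rcases lt_or_gt_of_ne hij with hlt | hgt
      · have := ih i hlt
        rw [← map_natCast (C (R := K)), ← map_natCast (C (R := K)), this, sub_self]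
      · have : ∀ m : ℕ, coeff j ((m : PowerSeries K) * (C (i : K) * (X ^ i * (1 + X ^ i)⁻¹))) = 0 := by
          intro m
          rw [← map_natCast (C (R := K)), coeff_C_mul, coeff_C_mul, coeff_X_pow_mul',
            if_neg (by omega)]
          simp
        rw [this, this, sub_self]
    · intro hj'
      rw [Multiset.mem_toFinset, Multiset.mem_add, not_or] at hj'
      rw [Multiset.count_eq_zero.2 hj'.1, Multiset.count_eq_zero.2 hj'.2, sub_self]

open Polynomial in
lemma eq_of_prod_one_add_X_pow_eq {p : ℕ} [Fact p.Prime] (s t : Multiset ℕ)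
    (hs : ∀ i ∈ s, ¬ p ∣ i) (ht : ∀ i ∈ t, ¬ p ∣ i)
    (h : (s.map fun i => (1 + X ^ i : (ZMod p)[X])).prod
      = (t.map fun i => (1 + X ^ i : (ZMod p)[X])).prod) : s = t := by
  induction hN : s.card + t.card using Nat.strong_induction_on generalizing s t with
  | _ N ih =>
    let f : Multiset ℕ → (ZMod p)[X] := fun s => (s.map fun i => (1 + X ^ i)).prod
    have f_add : ∀ a b, f (a + b) = f a * f b := fun a b => by simp [f]
    have f_smul : ∀ (k : ℕ) a, f (k • a) = f a ^ k := fun k a => by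
      simp [f, Multiset.map_nsmul, Multiset.prod_nsmul]
    have f_ne : ∀ a : Multiset ℕ, (∀ i ∈ a, ¬ p ∣ i) → f a ≠ 0 := by
      intro a ha h0
      obtain ⟨i, hi, h0⟩ := Multiset.mem_map.1 (Multiset.prod_eq_zero_iff.1 h0)
      have hi0 : i ≠ 0 := by rintro rfl; exact ha 0 hi (dvd_zero p)
      have := congrArg (fun q => coeff q 0) h0
      simp [coeff_X_pow, hi0.symm] at this
    have hst : f (s - t) = f (t - s) := by
      have hs' : s = (s - t) + s ∩ t := (Multiset.sub_add_inter s t).symm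
      have ht' : t = (t - s) + s ∩ t := by
        rw [Multiset.inter_comm]; exact (Multiset.sub_add_inter t s).symm
      have h2 : f s = f t := h
      have h3 : f ((s - t) + s ∩ t) = f ((t - s) + s ∩ t) := by rw [← hs', ← ht']; exact h
      rw [f_add, f_add] at h3
      exact mul_right_cancel₀
        (f_ne _ fun i hi => hs i (Multiset.mem_of_le Multiset.inter_le_left hi)) h3
    have hs1 : ∀ i ∈ s - t, ¬ p ∣ i := fun i hi => hs i (Multiset.mem_of_le (Multiset.sub_le_self _ _) hi)
    have ht1 : ∀ i ∈ t - s, ¬ p ∣ i := fun i hi => ht i (Multiset.mem_of_le (Multiset.sub_le_self _ _) hi)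
    have hlog : logDerivSeries (ZMod p) (s - t) = logDerivSeries (ZMod p) (t - s) := by
      have cf : ∀ a : Multiset ℕ, ((f a : (ZMod p)[X]) : PowerSeries (ZMod p))
          = (a.map fun i => (1 + PowerSeries.X ^ i : PowerSeries (ZMod p))).prod := by
        intro a
        have := map_multiset_prod (Polynomial.coeToPowerSeries.ringHom (R := ZMod p))
          (a.map fun i => (1 + X ^ i : (ZMod p)[X]))
        simpa [f, Multiset.map_map, Function.comp_def] using this
      have e1 := X_mul_derivative_prod_one_add (K := ZMod p) (s - t)
        (fun h => hs1 0 h (dvd_zero p))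
      have e2 := X_mul_derivative_prod_one_add (K := ZMod p) (t - s)
        (fun h => ht1 0 h (dvd_zero p))
      rw [← cf] at e1 e2
      rw [← hst, e1] at e2
      refine mul_left_cancel₀ ?_ e2
      rw [Ne, Polynomial.coe_eq_zero_iff]
      exact f_ne _ hs1
    have hcount := count_cast_eq_of_logDerivSeries_eq (K := ZMod p) (s - t) (t - s)
      (fun i hi => by rw [Ne, ZMod.natCast_eq_zero_iff]; exact hs1 i hi)
      (fun i hi => by rw [Ne, ZMod.natCast_eq_zero_iff]; exact ht1 i hi) hlog
    have hdvd : ∀ i, p ∣ (s - t).count i ∧ p ∣ (t - s).count i := by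
      intro i
      have := hcount i
      rw [← ZMod.natCast_eq_zero_iff, ← ZMod.natCast_eq_zero_iff, ← this, and_self]
      rcases le_total (s.count i) (t.count i) with hle | hle
      · rw [Multiset.count_sub, Nat.sub_eq_zero_of_le hle, Nat.cast_zero]
      · rw [this, Multiset.count_sub, Nat.sub_eq_zero_of_le hle, Nat.cast_zero]
    obtain ⟨u, hu⟩ := Multiset.exists_smul_of_dvd_count (s - t) fun a _ => (hdvd a).1
    obtain ⟨v, hv⟩ := Multiset.exists_smul_of_dvd_count (t - s) fun a _ => (hdvd a).2
    have hp := (Fact.out : p.Prime)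
    have huv : u = v := by
      by_cases h0 : u.card + v.card = 0
      · have h1 : u.card = 0 := by omega
        have h2 : v.card = 0 := by omega
        rw [Multiset.card_eq_zero.1 h1, Multiset.card_eq_zero.1 h2]
      · refine ih (u.card + v.card) ?_ u v ?_ ?_ ?_ rfl
        · have c1 := Multiset.card_le_card (Multiset.sub_le_self s t)
          have c2 := Multiset.card_le_card (Multiset.sub_le_self t s)
          rw [hu, Multiset.card_nsmul] at c1
          rw [hv, Multiset.card_nsmul] at c2
          have := hp.two_le
          have := Nat.mul_le_mul_right u.card hp.two_le
          have := Nat.mul_le_mul_right v.card hp.two_le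
          omega
        · exact fun i hi => hs1 i (by rw [hu]; exact (Multiset.mem_nsmul_of_ne_zero hp.ne_zero).2 hi)
        · exact fun i hi => ht1 i (by rw [hv]; exact (Multiset.mem_nsmul_of_ne_zero hp.ne_zero).2 hi)
        · rw [hu, hv, f_smul, f_smul] at hst
          exact frobenius_inj (ZMod p)[X] p hst
    have heq : s - t = t - s := by rw [hu, hv, huv]
    ext i
    have := congrArg (Multiset.count i) heq
    rw [Multiset.count_sub, Multiset.count_sub] at this
    omega

/-- The functions `{1,…,n} → {1,…,s}` whose fibres have the sizes prescribed by `q` and which are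
constant on the cycles of `σ`. -/
def youngFuns {n : ℕ} (q : Composition n) (σ : Equiv.Perm (Fin n)) :
    Finset (Fin n → Fin q.length) :=
  Finset.univ.filter fun h =>
    (∀ i, (Finset.univ.filter fun x => h x = i).card = q.blocksFun i) ∧ ∀ x, h (σ x) = h x

lemma mem_youngFuns {n : ℕ} {q : Composition n} {σ : Equiv.Perm (Fin n)}
    {h : Fin n → Fin q.length} : h ∈ youngFuns q σ ↔
      (∀ i, (Finset.univ.filter fun x => h x = i).card = q.blocksFun i) ∧ ∀ x, h (σ x) = h x := by
  simp [youngFuns]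

lemma youngChar_eq_card_youngFuns {n : ℕ} (q : Composition n) (σ : Equiv.Perm (Fin n)) :
    youngChar q σ = (youngFuns q σ).card := by
  symm
  refine Finset.card_bij (fun h _ i => Finset.univ.filter fun x => h x = i) ?_ ?_ ?_
  · intro h hh
    rw [mem_youngFuns] at hh
    simp only [Finset.mem_filter, Finset.mem_univ, true_and]
    refine ⟨hh.1, fun i j hij => ?_, fun x => ⟨h x, rfl⟩, fun i x hx => by rw [hh.2, hx]⟩
    rw [Finset.disjoint_left]
    rintro x hx hx'
    simp only [Finset.mem_filter, Finset.mem_univ, true_and] at hx hx'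
    exact hij (hx.symm.trans hx')
  · intro h _ h' _ e
    funext x
    have : x ∈ Finset.univ.filter fun y => h' y = h x := by
      rw [← congrFun e (h x)]; simp
    exact (Finset.mem_filter.1 this).2.symm
  · intro P hP
    simp only [Finset.mem_filter, Finset.mem_univ, true_and] at hP
    obtain ⟨h1, h2, h3, h4⟩ := hP
    choose f hf using h3
    have hfi : ∀ x i, x ∈ P i → f x = i := by
      intro x i hx
      by_contra hne
      exact Finset.disjoint_left.1 (h2 _ _ hne) (hf x) hx
    have hP : (fun i => Finset.univ.filter fun x => f x = i) = P := by
      funext i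
      ext x
      simp only [Finset.mem_filter, Finset.mem_univ, true_and]
      exact ⟨fun h => h ▸ hf x, hfi x i⟩
    refine ⟨f, mem_youngFuns.2 ⟨fun i => ?_, fun x => hfi _ _ (h4 _ _ (hf x))⟩, hP⟩
    rw [← h1 i, ← hP]

lemma card_fiber_comp_perm {α β : Type*} [Fintype α] [DecidableEq β] (h : α → β) (g : Equiv.Perm α) (b : β) :
    (Finset.univ.filter fun x => h (g x) = b).card = (Finset.univ.filter fun x => h x = b).card := by
  refine Finset.card_bij (fun x _ => g x) ?_ ?_ ?_
  · intro x hx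
    simpa using hx
  · intro x _ y _ e
    exact g.injective e
  · intro y hy
    exact ⟨g⁻¹ y, by simpa using hy, by simp⟩

lemma youngChar_eq_of_isConj {n : ℕ} (q : Composition n) {σ τ : Equiv.Perm (Fin n)}
    (h : IsConj σ τ) : youngChar q σ = youngChar q τ := by
  obtain ⟨g, rfl⟩ := isConj_iff.1 h
  rw [youngChar_eq_card_youngFuns, youngChar_eq_card_youngFuns]
  refine Finset.card_bij (fun f _ x => f (g⁻¹ x)) ?_ ?_ ?_
  · intro f hf
    rw [mem_youngFuns] at hf ⊢
    exact ⟨fun i => by rw [card_fiber_comp_perm, hf.1], fun x => by simp [hf.2]⟩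
  · intro f _ f' _ e
    funext x
    simpa using congrFun e (g x)
  · intro f hf
    rw [mem_youngFuns] at hf
    refine ⟨fun x => f (g x), mem_youngFuns.2 ⟨fun i => by rw [card_fiber_comp_perm, hf.1],
      fun x => ?_⟩, by simp⟩
    simpa using hf.2 (g x)

lemma youngChar_pow_modEq {n p : ℕ} [Fact p.Prime] (q : Composition n) (σ : Equiv.Perm (Fin n))
    (k : ℕ) : youngChar q (σ ^ p ^ k) ≡ youngChar q σ [MOD p] := by
  rw [youngChar_eq_card_youngFuns, youngChar_eq_card_youngFuns]
  have hcomm : ∀ x, (σ ^ p ^ k) (σ x) = σ ((σ ^ p ^ k) x) := fun x => by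
    rw [← Equiv.Perm.mul_apply, ← Equiv.Perm.mul_apply, ← pow_succ, ← pow_succ']
  let F : Function.End (youngFuns q (σ ^ p ^ k)) := fun h => ⟨fun x => h.1 (σ x), by
    have hh := mem_youngFuns.1 h.2
    exact mem_youngFuns.2 ⟨fun i => by rw [card_fiber_comp_perm, hh.1],
      fun x => by rw [← hcomm, hh.2]⟩⟩
  have hF : ∀ m : ℕ, ∀ h, ((F ^ m) h).1 = fun x => h.1 ((σ ^ m) x) := by
    intro m
    induction m with
    | zero => intro h; rfl
    | succ m ih =>
      intro h
      have e : (F ^ (m + 1)) h = (F ^ m) (F h) := by rw [pow_succ]; rfl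
      rw [e, ih]
      funext x
      rw [pow_succ']
      rfl
  have hF1 : F ^ p ^ k = 1 := by
    funext h
    apply Subtype.ext
    rw [hF]
    funext x
    exact (mem_youngFuns.1 h.2).2 x
  have key := Equiv.Perm.card_fixedPoints_modEq hF1
  rw [Fintype.card_coe] at key
  convert! key using 1
  rw [← Fintype.card_coe]
  refine Fintype.card_congr ⟨fun h => ⟨⟨h.1, ?_⟩, ?_⟩, fun h => ⟨h.1.1, ?_⟩, ?_, ?_⟩
  · have hh := mem_youngFuns.1 h.2
    refine mem_youngFuns.2 ⟨hh.1, ?_⟩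
    generalize p ^ k = m
    induction m with
    | zero => simp
    | succ m ih => intro x; rw [pow_succ', Equiv.Perm.mul_apply, hh.2, ih]
  · apply Subtype.ext
    funext x
    exact (mem_youngFuns.1 h.2).2 x
  · have hh := mem_youngFuns.1 h.1.2
    exact mem_youngFuns.2 ⟨hh.1, fun x => congrFun (congrArg Subtype.val h.2) x⟩
  · intro h; rfl
  · intro h; rfl

lemma exists_pow_partition_regular {n p : ℕ} [Fact p.Prime] (σ : Equiv.Perm (Fin n)) :
    ∃ k : ℕ, ∀ i ∈ (σ ^ p ^ k).partition.parts, ¬ p ∣ i := by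
  have hp := (Fact.out : p.Prime)
  obtain ⟨k, m, hm, hk⟩ := Nat.exists_eq_pow_mul_and_not_dvd (orderOf_pos σ).ne' p hp.ne_one
  refine ⟨k, fun i hi hpi => ?_⟩
  rw [Equiv.Perm.parts_partition, Multiset.mem_add] at hi
  rcases hi with hi | hi
  · have h1 := Equiv.Perm.dvd_of_mem_cycleType hi
    rw [orderOf_pow, hk, Nat.gcd_eq_right (Dvd.intro _ rfl),
      Nat.mul_div_cancel_left _ (pow_pos hp.pos k)] at h1
    exact hm (hpi.trans h1)
  · rw [Multiset.eq_of_mem_replicate hi] at hpi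
    exact hp.one_lt.ne' (Nat.dvd_one.1 hpi)

/-- The `σ`-invariant subsets. -/
def invSets {α : Type*} [Fintype α] (σ : Equiv.Perm α) : Finset (Finset α) :=
  Finset.univ.filter fun S => ∀ x ∈ S, σ x ∈ S

open Equiv.Perm in
lemma sum_invSets {n : ℕ} {R : Type*} [CommSemiring R] (t : R) (σ : Equiv.Perm (Fin n)) :
    ∑ S ∈ invSets σ, t ^ S.card = (σ.partition.parts.map fun i => 1 + t ^ i).prod := by
  have hsub : ∀ c ∈ σ.cycleFactorsFinset, c.support ⊆ σ.support :=
    fun c hc => mem_cycleFactorsFinset_support_le hc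
  have hdisj : ∀ c ∈ σ.cycleFactorsFinset, ∀ c' ∈ σ.cycleFactorsFinset, ∀ x,
      x ∈ c.support → x ∈ c'.support → c = c' := by
    intro c hc c' hc' x hx hx'
    by_contra hne
    exact Finset.disjoint_left.1
      (cycleFactorsFinset_pairwise_disjoint σ hc hc' hne).disjoint_support hx hx'
  have hcard : ∀ T ∈ σ.cycleFactorsFinset.powerset, ∀ U ∈ (σ.supportᶜ).powerset,
      (T.biUnion support ∪ U).card = ∑ c ∈ T, c.support.card + U.card := by
    intro T hT U hU
    rw [Finset.mem_powerset] at hT hU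
    rw [Finset.card_union_of_disjoint, Finset.card_biUnion]
    · intro c hc c' hc' hne
      exact (cycleFactorsFinset_pairwise_disjoint σ (hT hc) (hT hc') hne).disjoint_support
    · rw [Finset.disjoint_left]
      intro x hx hxU
      obtain ⟨c, hc, hx⟩ := Finset.mem_biUnion.1 hx
      exact Finset.mem_compl.1 (hU hxU) (hsub c (hT hc) hx)
  rw [parts_partition, cycleType_def, Multiset.map_add, Multiset.prod_add, Multiset.map_map,
    Multiset.map_replicate, Multiset.prod_replicate, pow_one, Fintype.card_fin]
  have hfix : (1 + t) ^ (n - σ.support.card) = ∏ _x ∈ σ.supportᶜ, (1 + t) := by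
    rw [Finset.prod_const, Finset.card_compl, Fintype.card_fin]
  have hcyc : (σ.cycleFactorsFinset.val.map
      ((fun i => 1 + t ^ i) ∘ (Finset.card ∘ support))).prod
      = ∏ c ∈ σ.cycleFactorsFinset, (1 + t ^ c.support.card) := rfl
  rw [hfix, hcyc, Finset.prod_one_add, Finset.prod_one_add, Finset.sum_mul_sum,
    ← Finset.sum_product']
  symm
  refine Finset.sum_bij' (fun TU _ => TU.1.biUnion support ∪ TU.2)
    (fun S _ => (σ.cycleFactorsFinset.filter fun c => c.support ⊆ S, S ∩ σ.supportᶜ)) ?_ ?_ ?_ ?_ ?_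
  · rintro ⟨T, U⟩ h
    rw [Finset.mem_product, Finset.mem_powerset, Finset.mem_powerset] at h
    simp only [invSets, Finset.mem_filter, Finset.mem_univ, true_and, Finset.mem_union,
      Finset.mem_biUnion]
    rintro x (⟨c, hc, hx⟩ | hx)
    · refine Or.inl ⟨c, hc, ?_⟩
      rw [← (mem_cycleFactorsFinset_iff.1 (h.1 hc)).2 x hx]
      exact apply_mem_support.2 hx
    · refine Or.inr ?_
      have := Finset.mem_compl.1 (h.2 hx)
      rwa [notMem_support.1 this]
  · intro S _
    simp
  · rintro ⟨T, U⟩ h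
    rw [Finset.mem_product, Finset.mem_powerset, Finset.mem_powerset] at h
    obtain ⟨hT, hU⟩ := h
    refine Prod.ext ?_ ?_
    · ext c
      simp only [Finset.mem_filter]
      constructor
      · rintro ⟨hc, hcs⟩
        obtain ⟨x, hx⟩ := (mem_cycleFactorsFinset_iff.1 hc).1.nonempty_support
        rcases Finset.mem_union.1 (hcs hx) with hx' | hx'
        · obtain ⟨c', hc', hx'⟩ := Finset.mem_biUnion.1 hx'
          rwa [hdisj c hc c' (hT hc') x hx hx']
        · exact absurd (hsub c hc hx) (Finset.mem_compl.1 (hU hx'))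
      · intro hc
        exact ⟨hT hc, fun x hx => Finset.mem_union_left _ (Finset.mem_biUnion.2 ⟨c, hc, hx⟩)⟩
    · ext x
      simp only [Finset.mem_inter, Finset.mem_union, Finset.mem_biUnion, Finset.mem_compl]
      constructor
      · rintro ⟨⟨c, hc, hx⟩ | hx, hx'⟩
        · exact absurd (hsub c (hT hc) hx) hx'
        · exact hx
      · exact fun hx => ⟨Or.inr hx, Finset.mem_compl.1 (hU hx)⟩
  · intro S hS
    simp only [invSets, Finset.mem_filter, Finset.mem_univ, true_and] at hS
    ext x
    simp only [Finset.mem_inter, Finset.mem_union, Finset.mem_biUnion, Finset.mem_compl,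
      Finset.mem_filter]
    constructor
    · rintro (⟨c, ⟨_, hc⟩, hx⟩ | hx)
      · exact hc hx
      · exact hx.1
    · intro hx
      by_cases hxs : x ∈ σ.support
      · refine Or.inl ⟨σ.cycleOf x, ⟨cycleOf_mem_cycleFactorsFinset_iff.2 hxs, fun y hy => ?_⟩, ?_⟩
        · obtain ⟨k, -, rfl⟩ := (mem_support_cycleOf_iff.1 hy).1.exists_pow_eq'
          clear hy
          induction k with
          | zero => exact hx
          | succ k ih => rw [pow_succ', mul_apply]; exact hS _ ih
        · exact mem_support_cycleOf_iff.2 ⟨SameCycle.refl _ _, hxs⟩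
      · exact Or.inr ⟨hx, hxs⟩
  · rintro ⟨T, U⟩ h
    rw [Finset.mem_product] at h
    rw [hcard T h.1 U h.2, pow_add, ← Finset.prod_pow_eq_pow_sum, Finset.prod_const]

lemma youngChar_pair {n k : ℕ} (h0 : 0 < k) (hk : k < n) (σ : Equiv.Perm (Fin n)) :
    youngChar (⟨[k, n - k], by
      intro i hi
      simp only [List.mem_cons, List.not_mem_nil, or_false] at hi
      omega, by simp; omega⟩ : Composition n) σ = ((invSets σ).filter fun S => S.card = k).card := by
  refine Finset.card_bij' (fun P _ => P ⟨0, Nat.zero_lt_two⟩)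
    (fun S _ i => if i.1 = 0 then S else Sᶜ) ?_ ?_ ?_ ?_
  · intro P hP
    simp only [Finset.mem_filter, Finset.mem_univ, true_and, invSets] at hP ⊢
    exact ⟨hP.2.2.2 _, hP.1 _⟩
  · intro S hS
    simp only [Finset.mem_filter, Finset.mem_univ, true_and, invSets] at hS ⊢
    have hinv : ∀ x ∉ S, σ x ∉ S := by
      have himg : S.map σ.toEmbedding = S := by
        refine Finset.eq_of_subset_of_card_le (fun y hy => ?_) (by simp)
        obtain ⟨x, hx, rfl⟩ := Finset.mem_map.1 hy
        exact hS.1 x hx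
      intro x hx hx'
      rw [← himg] at hx'
      obtain ⟨y, hy, e⟩ := Finset.mem_map.1 hx'
      exact hx (σ.injective e ▸ hy)
    refine ⟨?_, ?_, ?_, ?_⟩
    · rintro ⟨_ | _ | i, hi⟩
      · exact hS.2
      · simp [Finset.card_compl, hS.2, Composition.blocksFun]
      · exact absurd hi (by simp [Composition.length])
    · rintro ⟨i, hi⟩ ⟨j, hj⟩ hij
      have hi : i < 2 := hi
      have hj : j < 2 := hj
      have hij : i ≠ j := fun h => hij (Fin.ext h)
      interval_cases i <;> interval_cases j <;> simp_all [disjoint_compl_right, disjoint_compl_left]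
    · intro x
      by_cases hx : x ∈ S
      · exact ⟨⟨0, Nat.zero_lt_two⟩, by simpa using hx⟩
      · exact ⟨⟨1, Nat.one_lt_two⟩, by simpa using hx⟩
    · rintro ⟨i, hi⟩ x hx
      by_cases h : i = 0
      · simp only [h, if_true] at hx ⊢
        exact hS.1 x hx
      · simp only [h, if_false, Finset.mem_compl] at hx ⊢
        exact hinv x hx
  · intro P hP
    simp only [Finset.mem_filter, Finset.mem_univ, true_and] at hP
    obtain ⟨h1, h2, h3, h4⟩ := hP
    funext ⟨i, hi⟩
    have hi' : i < 2 := hi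
    interval_cases i
    · rfl
    · simp only [one_ne_zero, if_false]
      ext x
      rw [Finset.mem_compl]
      constructor
      · intro hx
        obtain ⟨⟨j, hj⟩, hxj⟩ := h3 x
        have hj' : j < 2 := hj
        interval_cases j
        · exact absurd hxj hx
        · exact hxj
      · intro hx hx'
        exact Finset.disjoint_left.1 (h2 _ _ (by simp)) hx hx'
  · intro S hS
    simp

open Polynomial in
lemma parts_eq_of_youngCharMod_eq {n p : ℕ} [Fact p.Prime] {σ τ : Equiv.Perm (Fin n)}
    (hσ : ∀ i ∈ σ.partition.parts, ¬ p ∣ i) (hτ : ∀ i ∈ τ.partition.parts, ¬ p ∣ i)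
    (h : ∀ q, youngCharMod n p q σ = youngCharMod n p q τ) :
    σ.partition.parts = τ.partition.parts := by
  refine eq_of_prod_one_add_X_pow_eq (p := p) _ _ hσ hτ ?_
  rw [← sum_invSets, ← sum_invSets]
  ext k
  have hcoeff : ∀ ρ : Equiv.Perm (Fin n), coeff (∑ S ∈ invSets ρ, (X : (ZMod p)[X]) ^ S.card) k
      = (((invSets ρ).filter fun S => S.card = k).card : ZMod p) := by
    intro ρ
    simp [coeff_X_pow, eq_comm]
  have hconst : ∀ (T : Finset (Fin n)), (∀ ρ : Equiv.Perm (Fin n), T ∈ invSets ρ) →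
      (∀ S : Finset (Fin n), S.card = k ↔ S = T) → ∀ ρ : Equiv.Perm (Fin n),
      ((invSets ρ).filter fun S => S.card = k) = {T} := by
    intro T hT hT' ρ
    ext S
    rw [Finset.mem_filter, Finset.mem_singleton, hT']
    exact ⟨fun h => h.2, fun h => ⟨h ▸ hT ρ, h⟩⟩
  rw [hcoeff, hcoeff]
  rcases Nat.eq_zero_or_pos k with rfl | h0
  · rw [hconst ∅ (by simp [invSets]) (by simp) σ, hconst ∅ (by simp [invSets]) (by simp) τ]
  rcases lt_trichotomy k n with hk | rfl | hk
  · rw [← youngChar_pair h0 hk, ← youngChar_pair h0 hk]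
    exact h _
  · have hT : ∀ S : Finset (Fin k), S.card = k ↔ S = Finset.univ := fun S => by
      rw [← Finset.card_eq_iff_eq_univ, Fintype.card_fin]
    rw [hconst Finset.univ (by simp [invSets]) hT σ, hconst Finset.univ (by simp [invSets]) hT τ]
  · have hempty : ∀ ρ : Equiv.Perm (Fin n), ((invSets ρ).filter fun S => S.card = k) = ∅ := by
      intro ρ
      refine Finset.filter_eq_empty_iff.2 fun S _ hS => ?_
      have := S.card_le_univ
      rw [Fintype.card_fin] at this
      omega
    rw [hempty, hempty]

/-- The left regular band `{0, +, -}` of signs: `a * b` is `a` unless `a` is neutral. -/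
instance orderingMonoid : Monoid Ordering where
  mul := Ordering.then
  one := .eq
  mul_assoc a b c := by cases a <;> rfl
  one_mul a := rfl
  mul_one a := by cases a <;> rfl

lemma ordering_mul_eq_one_iff (a b : Ordering) : a * b = .eq ↔ a = .eq ∧ b = .eq := by
  cases a <;> cases b <;> decide

lemma compare_mul_compare {α β γ : Type*} [LinearOrder α] [LinearOrder β] [LinearOrder γ]
    {a b : α} {c d : β} {e f : γ} (h1 : a < b → e < f) (h2 : b < a → f < e)
    (h3 : a = b → compare c d = compare e f) : compare a b * compare c d = compare e f := by
  rcases lt_trichotomy a b with h | h | h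
  · rw [compare_lt_iff_lt.2 h, compare_lt_iff_lt.2 (h1 h)]; rfl
  · rw [compare_eq_iff_eq.2 h, h3 h]; rfl
  · rw [compare_gt_iff_gt.2 h, compare_gt_iff_gt.2 (h2 h)]; rfl

/-- The monoid of sign matrices whose zero set is an equivalence relation; it contains the faces
of the braid arrangement, with the Tits product. -/
def faceMonoid (n : ℕ) : Submonoid (Fin n → Fin n → Ordering) where
  carrier := {s | Equivalence fun x y => s x y = .eq}
  one_mem' := ⟨fun _ => rfl, fun _ => rfl, fun _ _ => rfl⟩
  mul_mem' := by
    intro s t hs ht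
    simp only [Set.mem_ofPred_eq, Pi.mul_apply, ordering_mul_eq_one_iff] at hs ht ⊢
    exact ⟨fun x => ⟨hs.refl x, ht.refl x⟩, fun h => ⟨hs.symm h.1, ht.symm h.2⟩,
      fun h h' => ⟨hs.trans h.1 h'.1, ht.trans h.2 h'.2⟩⟩

/-- The face of the braid arrangement given by an ordered set partition. -/
def faceOf {n : ℕ} {α : Type*} [LinearOrder α] (h : Fin n → α) : faceMonoid n :=
  ⟨fun x y => compare (h x) (h y), by
    simp only [faceMonoid, Submonoid.mem_mk, Subsemigroup.mem_mk, Set.mem_ofPred_eq,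
      compare_eq_iff_eq]
    exact ⟨fun _ => rfl, fun h => h.symm, fun h h' => h.trans h'⟩⟩

lemma faceOf_apply {n : ℕ} {α : Type*} [LinearOrder α] (h : Fin n → α) (x y : Fin n) :
    (faceOf h).1 x y = compare (h x) (h y) := rfl

/-- The chamber of the braid arrangement given by a permutation written as a word. -/
def chamber {n : ℕ} (w : Equiv.Perm (Fin n)) : faceMonoid n := faceOf fun x => w⁻¹ x

lemma chamber_injective {n : ℕ} : Function.Injective (chamber (n := n)) := by
  intro v w h
  have hlt : ∀ x y, v⁻¹ x < v⁻¹ y ↔ w⁻¹ x < w⁻¹ y := by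
    intro x y
    have := congrFun (congrFun (congrArg Subtype.val h) x) y
    rw [chamber, chamber, faceOf_apply, faceOf_apply] at this
    rw [← compare_lt_iff_lt, this, compare_lt_iff_lt]
  have hmono : StrictMono (w⁻¹ * v : Equiv.Perm (Fin n)) := by
    intro a b hab
    rw [Equiv.Perm.mul_apply, Equiv.Perm.mul_apply, ← hlt]
    simpa using hab
  have : (hmono.orderIsoOfSurjective _ (w⁻¹ * v).surjective) = OrderIso.refl _ :=
    Subsingleton.elim _ _
  have h1 : w⁻¹ * v = 1 := by
    ext1 x
    exact DFunLike.congr_fun this x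
  exact (inv_mul_eq_one.1 h1).symm

lemma Composition.index_mono {n : ℕ} (q : Composition n) : Monotone q.index := by
  intro i j hij
  by_contra hlt
  rw [not_le] at hlt
  have h1 := q.lt_sizeUpTo_index_succ j
  have h2 := q.sizeUpTo_index_le i
  have h3 := q.monotone_sizeUpTo (show (q.index j).succ.1 ≤ (q.index i).1 from hlt)
  have h4 : (i : ℕ) ≤ j := hij
  omega

lemma Composition.card_filter_index {n : ℕ} (q : Composition n) (i : Fin q.length) :
    (Finset.univ.filter fun x => q.index x = i).card = q.blocksFun i := by
  have : (Finset.univ.filter fun x => q.index x = i)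
      = Finset.univ.map (q.embedding i).toEmbedding := by
    ext x
    simp only [Finset.mem_filter, Finset.mem_univ, true_and, Finset.mem_map]
    rw [eq_comm, ← q.mem_range_embedding_iff']
    simp
  rw [this, Finset.card_map, Finset.card_univ, Fintype.card_fin]

lemma descSet_subset_properPartialSums_iff {n : ℕ} (q : Composition n) (v : Equiv.Perm (Fin n)) :
    descSet v ⊆ properPartialSums q ↔ ∀ i j, i < j → q.index i = q.index j → v i < v j := by
  constructor
  · intro h
    suffices H : ∀ d : ℕ, ∀ i j : Fin n, j.1 = i.1 + (d + 1) → q.index i = q.index j → v i < v j by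
      intro i j hij
      have : i.1 < j.1 := hij
      exact H (j.1 - i.1 - 1) i j (by omega)
    have step : ∀ i j : Fin n, j.1 = i.1 + 1 → q.index i = q.index j → v i < v j := by
      intro i j hij hq
      by_contra hv
      have hne : v i ≠ v j := fun e => by
        have := congrArg Fin.val (v.injective e)
        omega
      have hd : j.1 ∈ descSet v := by
        refine ⟨j.2, by omega, ?_⟩
        have : (⟨j.1 - 1, by omega⟩ : Fin n) = i := Fin.ext (by simp; omega)
        rw [this]
        exact lt_of_le_of_ne (not_lt.1 hv) hne.symm
      obtain ⟨m, hm0, hml, hm⟩ := h hd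
      have h1 := q.sizeUpTo_index_le i
      have h2 := q.lt_sizeUpTo_index_succ j
      rw [hq] at h1
      rcases le_or_gt m (q.index j).1 with hle | hgt
      · have := q.monotone_sizeUpTo hle
        omega
      · have := q.monotone_sizeUpTo (show (q.index j).succ.1 ≤ m from hgt)
        omega
    intro d
    induction d with
    | zero => exact step
    | succ d ih =>
      intro i j hij hq
      have hk : i.1 + (d + 1) < n := by omega
      let k : Fin n := ⟨i.1 + (d + 1), hk⟩
      have hik : q.index i ≤ q.index k := q.index_mono (Fin.le_def.2 (by simp [k]))
      have hkj : q.index k ≤ q.index j := q.index_mono (Fin.le_def.2 (by simp [k]; omega))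
      have e : q.index i = q.index k := le_antisymm hik (hq ▸ hkj)
      exact (ih i k rfl e).trans (step k j (by simp [k]; omega) (e ▸ hq))
  · rintro h k ⟨hk, hk0, hv⟩
    have hlt : (⟨k - 1, by omega⟩ : Fin n) < ⟨k, hk⟩ := Fin.lt_def.2 (by simp; omega)
    have hne : q.index ⟨k - 1, by omega⟩ ≠ q.index ⟨k, hk⟩ := fun e => absurd (h _ _ hlt e) hv.not_gt
    have hlt' := lt_of_le_of_ne (q.index_mono hlt.le) hne
    refine ⟨(q.index ⟨k, hk⟩).1, by have : _ < _ := Fin.lt_def.1 hlt'; omega, Fin.is_lt _, ?_⟩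
    have h1 := q.sizeUpTo_index_le ⟨k, hk⟩
    have h2 := q.lt_sizeUpTo_index_succ ⟨k - 1, by omega⟩
    have h3 := q.monotone_sizeUpTo (show (q.index ⟨k - 1, by omega⟩).succ.1 ≤ _ from hlt')
    simp only at h1 h2
    omega

lemma comp_sort_eq_index {n : ℕ} (q : Composition n) (h : Fin n → Fin q.length)
    (hh : ∀ i, (Finset.univ.filter fun x => h x = i).card = q.blocksFun i) :
    h ∘ Tuple.sort h = q.index := by
  have hc : ∀ i, Nonempty ({x // q.index x = i} ≃ {x // h x = i}) := by
    intro i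
    refine ⟨Fintype.equivOfCardEq ?_⟩
    rw [Fintype.card_subtype, Fintype.card_subtype]
    convert! (q.card_filter_index i).trans (hh i).symm
  let e : Equiv.Perm (Fin n) := Equiv.ofFiberEquiv fun i => (hc i).some
  have he : h ∘ e = q.index := funext fun x => Equiv.ofFiberEquiv_map _ x
  rw [← he]
  exact Tuple.unique_monotone (Tuple.monotone_sort h) (he ▸ q.index_mono)

/-- The faces of type `q`, summed up in the monoid algebra. -/
def faceSum (n p : ℕ) (q : Composition n) : MonoidAlgebra (ZMod p) (faceMonoid n) :=
  ∑ h ∈ youngFuns q 1, MonoidAlgebra.of (ZMod p) (faceMonoid n) (faceOf h)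

/-- The linear map sending a permutation to its chamber. -/
def chamberMap (n p : ℕ) : GroupAlg n p →ₗ[ZMod p] MonoidAlgebra (ZMod p) (faceMonoid n) :=
  MonoidAlgebra.mapDomainLinearMap (ZMod p) (ZMod p) chamber

lemma chamberMap_of {n p : ℕ} (w : Equiv.Perm (Fin n)) :
    chamberMap n p (MonoidAlgebra.of (ZMod p) _ w)
      = MonoidAlgebra.of (ZMod p) (faceMonoid n) (chamber w) :=
  MonoidAlgebra.mapDomainLinearMap_single _ _ _

lemma chamberMap_injective (n p : ℕ) : Function.Injective (chamberMap n p) :=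
  MonoidAlgebra.mapDomain_injective chamber_injective

lemma faceOf_index_mul_chamber {n : ℕ} (q : Composition n) (v w : Equiv.Perm (Fin n))
    (hv : ∀ i j, i < j → q.index i = q.index j → v i < v j) :
    faceOf (fun x => q.index (v⁻¹ (w⁻¹ x))) * chamber w = chamber (w * v) := by
  apply Subtype.ext
  funext x y
  have aux : ∀ a b : Fin n, q.index a < q.index b → a < b := fun a b hab => by
    by_contra hba
    exact hab.not_ge (q.index_mono (not_lt.1 hba))
  change compare _ _ * compare _ _ = compare _ _
  simp only [mul_inv_rev, Equiv.Perm.mul_apply]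
  refine compare_mul_compare (aux _ _) (aux _ _) fun e => ?_
  generalize ha : v⁻¹ (w⁻¹ x) = a at e ⊢
  generalize hb : v⁻¹ (w⁻¹ y) = b at e ⊢
  rw [show w⁻¹ x = v a by simp [← ha], show w⁻¹ y = v b by simp [← hb]]
  rcases lt_trichotomy a b with h | h | h
  · rw [compare_lt_iff_lt.2 h, compare_lt_iff_lt.2 (hv _ _ h e)]
  · rw [h, compare_eq_iff_eq.2 rfl, compare_eq_iff_eq.2 rfl]
  · rw [compare_gt_iff_gt.2 h, compare_gt_iff_gt.2 (hv _ _ h e.symm)]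

lemma faceSum_mul_chamberMap {n p : ℕ} (q : Composition n) (a : GroupAlg n p) :
    faceSum n p q * chamberMap n p a = chamberMap n p (a * Bel n p q) := by
  induction a using MonoidAlgebra.induction_on with
  | add x y hx hy => rw [map_add, mul_add, hx, hy, add_mul, map_add]
  | smul r x hx => rw [map_smul, mul_smul_comm, hx, smul_mul_assoc, map_smul]
  | of w =>
    rw [chamberMap_of, faceSum, Bel, Finset.sum_mul, Finset.mul_sum, map_sum]
    have hsort : ∀ h ∈ youngFuns q 1, (fun x => h (w x)) ∘ Tuple.sort (fun x => h (w x)) = q.index :=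
      fun h hh => comp_sort_eq_index q _ fun i => by
        rw [card_fiber_comp_perm, (mem_youngFuns.1 hh).1]
    have hinv : ∀ h ∈ youngFuns q 1,
        (fun x => q.index ((Tuple.sort fun x => h (w x))⁻¹ (w⁻¹ x))) = h := by
      intro h hh
      funext x
      rw [← hsort h hh]
      simp
    have hdes : ∀ h ∈ youngFuns q 1, ∀ i j, i < j → q.index i = q.index j →
        Tuple.sort (fun x => h (w x)) i < Tuple.sort (fun x => h (w x)) j := by
      intro h hh i j hij e
      refine (Tuple.eq_sort_iff.1 (rfl : Tuple.sort (fun x => h (w x)) = _)).2 i j hij ?_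
      rw [← hsort h hh] at e
      exact e
    refine Finset.sum_bij' (fun h _ => Tuple.sort fun x => h (w x))
      (fun v _ x => q.index (v⁻¹ (w⁻¹ x))) ?_ ?_ hinv ?_ ?_
    · intro h hh
      rw [Finset.mem_filter, descSet_subset_properPartialSums_iff]
      exact ⟨Finset.mem_univ _, hdes h hh⟩
    · intro v hv
      refine mem_youngFuns.2 ⟨fun i => ?_, fun x => rfl⟩
      rw [card_fiber_comp_perm (fun x => q.index (v⁻¹ x)), card_fiber_comp_perm,
        q.card_filter_index]
    · intro v hv
      rw [Finset.mem_filter, descSet_subset_properPartialSums_iff] at hv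
      symm
      rw [Tuple.eq_sort_iff]
      have hx : ∀ x, q.index (v⁻¹ (w⁻¹ (w (v x)))) = q.index x := fun x => by simp
      simp only [Function.comp_def, hx]
      exact ⟨q.index_mono, hv.2⟩
    · intro h hh
      rw [← map_mul, ← map_mul, chamberMap_of]
      congr 1
      conv_lhs => rw [← hinv h hh]
      exact faceOf_index_mul_chamber q _ w (hdes h hh)

/-- The face `s` is neutral on all pairs related by `r`. -/
def VanishesOn {n : ℕ} (r : Fin n → Fin n → Prop) (s : faceMonoid n) : Prop :=
  ∀ x y, r x y → s.1 x y = .eq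

lemma vanishesOn_mul {n : ℕ} (r : Fin n → Fin n → Prop) (s t : faceMonoid n) :
    VanishesOn r (s * t) ↔ VanishesOn r s ∧ VanishesOn r t := by
  simp only [VanishesOn, Submonoid.coe_mul, Pi.mul_apply, ordering_mul_eq_one_iff, imp_and,
    forall_and]

/-- The character of the face algebra attached to a relation `r`: the sum of the coefficients of
the faces vanishing on `r`. -/
def faceEval {n : ℕ} (p : ℕ) (r : Fin n → Fin n → Prop) :
    MonoidAlgebra (ZMod p) (faceMonoid n) →ₐ[ZMod p] ZMod p :=
  MonoidAlgebra.lift (ZMod p) (ZMod p) (faceMonoid n)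
    { toFun := fun s => if VanishesOn r s then 1 else 0
      map_one' := if_pos fun _ _ _ => rfl
      map_mul' := by
        intro s t
        by_cases h1 : VanishesOn r s <;> by_cases h2 : VanishesOn r t <;>
          simp [vanishesOn_mul, h1, h2] }

lemma faceEval_of {n p : ℕ} (r : Fin n → Fin n → Prop) (s : faceMonoid n) :
    faceEval p r (MonoidAlgebra.of (ZMod p) _ s) = if VanishesOn r s then 1 else 0 := by
  rw [faceEval, MonoidAlgebra.lift_of]
  rfl

lemma exists_perm_of_equivalence {α : Type*} [Fintype α] (r : Setoid α) :
    ∃ σ : Equiv.Perm α, (∀ x, r x (σ x)) ∧ ∀ x y, r x y → ∃ k : ℕ, (σ ^ k) x = y := by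
  have hc : ∀ c : Quotient r, ∃ f : Equiv.Perm α,
      f.IsCycleOn ((Finset.univ.filter fun x => (⟦x⟧ : Quotient r) = c : Finset α) : Set α) :=
    fun c => (Finset.exists_cycleOn _).imp fun _ h => h.1
  choose f hf using hc
  have hmem : ∀ c x, (⟦x⟧ : Quotient r) = c → (⟦f c x⟧ : Quotient r) = c := by
    intro c x hx
    have := (hf c).1.mapsTo (show x ∈ _ by simpa using hx)
    simpa using this
  have hinj : Function.Injective fun x => f ⟦x⟧ x := by
    intro x y e
    have e : f ⟦x⟧ x = f ⟦y⟧ y := e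
    have hxy : (⟦x⟧ : Quotient r) = ⟦y⟧ := by
      rw [← hmem _ x rfl, ← hmem _ y rfl, e]
    rw [hxy] at e
    exact (f _).injective e
  let σ : Equiv.Perm α := Equiv.ofBijective _ (Finite.injective_iff_bijective.1 hinj)
  have hσ : ∀ x, σ x = f ⟦x⟧ x := fun x => rfl
  refine ⟨σ, fun x => ?_, fun x y hxy => ?_⟩
  · exact Quotient.exact (hmem _ x rfl).symm
  · obtain ⟨k, -, hk⟩ := (hf ⟦x⟧).exists_pow_eq (show x ∈ _ by simp)
      (show y ∈ _ by simpa using Quotient.sound (r.symm hxy))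
    refine ⟨k, ?_⟩
    rw [← hk]
    clear hk
    have : ∀ k : ℕ, (σ ^ k) x = (f ⟦x⟧ ^ k) x ∧ (⟦(f ⟦x⟧ ^ k) x⟧ : Quotient r) = ⟦x⟧ := by
      intro k
      induction k with
      | zero => exact ⟨rfl, rfl⟩
      | succ k ih =>
        rw [pow_succ', pow_succ', Equiv.Perm.mul_apply, Equiv.Perm.mul_apply, ih.1, hσ, ih.2]
        exact ⟨rfl, hmem _ _ ih.2⟩
    exact (this k).1

lemma exists_faceEval_eq {n p : ℕ} (s : faceMonoid n) :
    ∃ σ : Equiv.Perm (Fin n), faceEval p (fun x y => s.1 x y = .eq)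
      = faceEval p (fun x y => y = σ x) := by
  obtain ⟨σ, h1, h2⟩ := exists_perm_of_equivalence ⟨_, s.2⟩
  have key : ∀ t : faceMonoid n, VanishesOn (fun x y => s.1 x y = .eq) t
      ↔ VanishesOn (fun x y => y = σ x) t := by
    intro t
    constructor
    · rintro h x y rfl
      exact h _ _ (h1 x)
    · intro h x y hxy
      obtain ⟨k, rfl⟩ := h2 x y hxy
      clear hxy
      have ht : Equivalence fun x y => t.1 x y = .eq := t.2
      induction k with
      | zero => exact ht.refl x
      | succ k ih =>
        rw [pow_succ', Equiv.Perm.mul_apply]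
        exact ht.trans ih (h _ _ rfl)
  refine ⟨σ, AlgHom.ext fun f => ?_⟩
  induction f using MonoidAlgebra.induction_on with
  | of t => simp only [faceEval_of, key]
  | add f g hf hg => rw [map_add, map_add, hf, hg]
  | smul c f hf => rw [map_smul, map_smul, hf]

lemma isNilpotent_of_faceEval_eq_zero {n p : ℕ} (f : MonoidAlgebra (ZMod p) (faceMonoid n))
    (hf : ∀ σ : Equiv.Perm (Fin n), faceEval p (fun x y => y = σ x) f = 0) : IsNilpotent f := by
  let z : faceMonoid n → ℕ := fun s =>
    (Finset.univ.filter fun xy : Fin n × Fin n => s.1 xy.1 xy.2 = .eq).card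
  let W : ℕ → Submodule (ZMod p) (MonoidAlgebra (ZMod p) (faceMonoid n)) := fun k =>
    Submodule.span _ {x | ∃ s, z s < k ∧ x = MonoidAlgebra.of (ZMod p) _ s}
  have hW : ∀ k, ∀ g ∈ W (k + 1), g * f ∈ W k := by
    intro k g hg
    induction hg using Submodule.span_induction with
    | zero => rw [zero_mul]; exact zero_mem _
    | add a b _ _ ha hb => rw [add_mul]; exact add_mem ha hb
    | smul c a _ ha => rw [smul_mul_assoc]; exact Submodule.smul_mem _ _ ha
    | mem g hg =>
      obtain ⟨s, hs, rfl⟩ := hg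
      obtain ⟨σ, hσ⟩ := exists_faceEval_eq (p := p) s
      have key : ∀ g : MonoidAlgebra (ZMod p) (faceMonoid n),
          MonoidAlgebra.of (ZMod p) _ s * g
            - faceEval p (fun x y => s.1 x y = .eq) g • MonoidAlgebra.of (ZMod p) _ s ∈ W k := by
        intro g
        induction g using MonoidAlgebra.induction_on with
        | add a b ha hb =>
          rw [mul_add, map_add, add_smul, add_sub_add_comm]
          exact add_mem ha hb
        | smul c a ha =>
          rw [mul_smul_comm, map_smul, smul_assoc, ← smul_sub]
          exact Submodule.smul_mem _ _ ha
        | of t =>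
          rw [faceEval_of, ← map_mul]
          split_ifs with h
          · have : s * t = s := by
              apply Subtype.ext
              funext x y
              have hxy : s.1 x y = .eq → t.1 x y = .eq := h x y
              change (s.1 x y).then (t.1 x y) = s.1 x y
              generalize s.1 x y = a at hxy ⊢
              cases a
              · rfl
              · exact hxy rfl
              · rfl
            rw [this, one_smul, sub_self]
            exact zero_mem _
          · rw [zero_smul, sub_zero]
            refine Submodule.subset_span ⟨s * t, ?_, rfl⟩
            refine lt_of_lt_of_le ?_ (Nat.lt_succ_iff.1 hs)
            refine Finset.card_lt_card (Finset.ssubset_iff_subset_ne.2 ⟨?_, ?_⟩)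
            · intro xy hxy
              rw [Finset.mem_filter] at hxy ⊢
              exact ⟨hxy.1, ((ordering_mul_eq_one_iff _ _).1 hxy.2).1⟩
            · intro he
              refine h fun x y hxy => ?_
              have : (x, y) ∈ Finset.univ.filter fun xy : Fin n × Fin n =>
                  (s * t).1 xy.1 xy.2 = .eq := by
                rw [he]; simpa using hxy
              exact ((ordering_mul_eq_one_iff _ _).1 (Finset.mem_filter.1 this).2).2
      have := key f
      rwa [hσ, hf, zero_smul, sub_zero] at this
  have hpow : ∀ k m, ∀ g ∈ W (k + m), g * f ^ m ∈ W k := by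
    intro k m
    induction m with
    | zero => intro g hg; simpa using hg
    | succ m ih =>
      intro g hg
      rw [pow_succ', ← mul_assoc]
      exact ih _ (hW _ g hg)
  have h0 : W 0 = ⊥ := by
    rw [Submodule.span_eq_bot]
    rintro _ ⟨s, hs, -⟩
    exact absurd hs (Nat.not_lt_zero _)
  refine ⟨z 1 + 1, ?_⟩
  have := hpow 0 (z 1 + 1) 1 (Submodule.subset_span ⟨1, by omega, (map_one _).symm⟩)
  rwa [h0, one_mul, Submodule.mem_bot] at this

lemma faceEval_faceSum {n p : ℕ} (q : Composition n) (σ : Equiv.Perm (Fin n)) :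
    faceEval p (fun x y => y = σ x) (faceSum n p q) = youngCharMod n p q σ := by
  rw [faceSum, map_sum, youngCharMod, youngChar_eq_card_youngFuns]
  simp only [faceEval_of]
  refine (Finset.sum_boole _ _).trans ?_
  congr 2
  ext h
  simp only [VanishesOn, Finset.mem_filter, mem_youngFuns, faceOf_apply, compare_eq_iff_eq, forall_eq]
  constructor
  · exact fun hh => ⟨hh.1.1, fun x => (hh.2 x).symm⟩
  · exact fun hh => ⟨⟨hh.1, fun x => rfl⟩, fun x => (hh.2 x).symm⟩

section Solomon

variable {n p : ℕ} (φ : descentAlgebra n p →ₐ[ZMod p] (Equiv.Perm (Fin n) → ZMod p))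

lemma exists_face_lift (hφ : ∀ q : Composition n, φ (BelS n p q) = youngCharMod n p q)
    (x : descentAlgebra n p) : ∃ f : MonoidAlgebra (ZMod p) (faceMonoid n),
      (∀ a, f * chamberMap n p a = chamberMap n p (a * x.1)) ∧
      ∀ σ, faceEval p (fun x y => y = σ x) f = φ x σ := by
  obtain ⟨x, hx⟩ := x
  induction hx using Algebra.adjoin_induction with
  | mem x hx =>
    obtain ⟨q, rfl⟩ := hx
    refine ⟨faceSum n p q, fun a => faceSum_mul_chamberMap q a, fun σ => ?_⟩
    rw [faceEval_faceSum, ← hφ]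
    rfl
  | algebraMap r =>
    refine ⟨algebraMap _ _ r, fun a => ?_, fun σ => ?_⟩
    · rw [← Algebra.smul_def, ← Algebra.commutes, ← Algebra.smul_def, map_smul]
    · rw [AlgHom.commutes]
      exact (congrFun (φ.commutes r) σ).symm
  | add x y hx hy ihx ihy =>
    obtain ⟨f, hf1, hf2⟩ := ihx
    obtain ⟨g, hg1, hg2⟩ := ihy
    refine ⟨f + g, fun a => ?_, fun σ => ?_⟩
    · rw [add_mul, hf1, hg1, ← map_add, ← mul_add]
    · rw [map_add, hf2, hg2]
      exact (congrFun (map_add φ ⟨x, hx⟩ ⟨y, hy⟩) σ).symm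
  | mul x y hx hy ihx ihy =>
    obtain ⟨f, hf1, hf2⟩ := ihx
    obtain ⟨g, hg1, hg2⟩ := ihy
    refine ⟨g * f, fun a => ?_, fun σ => ?_⟩
    · rw [mul_assoc, hf1, hg1, mul_assoc]
    · rw [map_mul, hf2, hg2, mul_comm]
      exact (congrFun (map_mul φ ⟨x, hx⟩ ⟨y, hy⟩) σ).symm

lemma isNilpotent_of_map_eq_zero (hφ : ∀ q : Composition n, φ (BelS n p q) = youngCharMod n p q)
    (x : descentAlgebra n p) (hx : φ x = 0) : IsNilpotent x := by
  obtain ⟨f, hf1, hf2⟩ := exists_face_lift φ hφ x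
  obtain ⟨k, hk⟩ := isNilpotent_of_faceEval_eq_zero f fun σ => by rw [hf2, hx]; rfl
  refine ⟨k, Subtype.ext (chamberMap_injective n p ?_)⟩
  have : ∀ m a, f ^ m * chamberMap n p a = chamberMap n p (a * x.1 ^ m) := by
    intro m
    induction m with
    | zero => simp
    | succ m ih =>
      intro a
      rw [pow_succ', mul_assoc, ih, hf1, mul_assoc, ← pow_succ]
  have h1 := this k 1
  rw [hk, zero_mul, one_mul] at h1
  simpa using h1.symm

lemma map_eq_of_youngCharMod_eq (hφ : ∀ q : Composition n, φ (BelS n p q) = youngCharMod n p q)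
    {σ τ : Equiv.Perm (Fin n)} (h : ∀ q, youngCharMod n p q σ = youngCharMod n p q τ)
    (x : descentAlgebra n p) : φ x σ = φ x τ := by
  have hgen : ∀ q, φ (BelS n p q) σ = φ (BelS n p q) τ := fun q => by rw [hφ, h]
  obtain ⟨x, hx⟩ := x
  induction hx using Algebra.adjoin_induction with
  | mem x hx =>
    obtain ⟨q, rfl⟩ := hx
    exact hgen q
  | algebraMap r =>
    exact (congrFun (φ.commutes r) σ).trans (congrFun (φ.commutes r) τ).symm
  | add x y hx hy ihx ihy =>
    have := map_add φ ⟨x, hx⟩ ⟨y, hy⟩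
    exact (congrFun this σ).trans ((congrArg₂ (· + ·) ihx ihy).trans (congrFun this τ).symm)
  | mul x y hx hy ihx ihy =>
    have := map_mul φ ⟨x, hx⟩ ⟨y, hy⟩
    exact (congrFun this σ).trans ((congrArg₂ (· * ·) ihx ihy).trans (congrFun this τ).symm)

lemma exists_regular_partition [Fact p.Prime]
    (hφ : ∀ q : Composition n, φ (BelS n p q) = youngCharMod n p q)
    (σ : n.Partition → Equiv.Perm (Fin n)) (hσ : ∀ π : n.Partition, (σ π).partition.parts = π.parts)
    (τ : Equiv.Perm (Fin n)) :
    ∃ π : n.Partition, (∀ i ∈ π.parts, ¬ p ∣ i) ∧ ∀ x, φ x τ = φ x (σ π) := by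
  obtain ⟨k, hk⟩ := exists_pow_partition_regular (p := p) τ
  let π : n.Partition := ⟨(τ ^ p ^ k).partition.parts, (τ ^ p ^ k).partition.parts_pos,
    (τ ^ p ^ k).partition.parts_sum.trans (Fintype.card_fin n)⟩
  refine ⟨π, hk, map_eq_of_youngCharMod_eq φ hφ fun q => ?_⟩
  have hconj : IsConj (τ ^ p ^ k) (σ π) :=
    Equiv.Perm.partition_eq_of_isConj.2 (Nat.Partition.ext (hσ π).symm)
  rw [youngCharMod, youngCharMod, ← youngChar_eq_of_isConj q hconj]
  exact ((ZMod.natCast_eq_natCast_iff _ _ _).2 (youngChar_pow_modEq q τ k)).symm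

lemma exists_smul_eq_of_isSimpleModule
    (hφ : ∀ q : Composition n, φ (BelS n p q) = youngCharMod n p q)
    (M : Type*) [AddCommGroup M] [Module (ZMod p) M] [Module (descentAlgebra n p) M]
    [IsScalarTower (ZMod p) (descentAlgebra n p) M] [IsSimpleModule (descentAlgebra n p) M] :
    ∃ τ, ∀ (x : descentAlgebra n p) (m : M), x • m = φ x τ • m := by
  have hspan : ∀ m : M, m ≠ 0 → ∀ m', ∃ x : descentAlgebra n p, x • m = m' := fun m hm =>
    IsSimpleModule.toSpanSingleton_surjective (descentAlgebra n p) hm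
  have hker : ∀ x : descentAlgebra n p, φ x = 0 → ∀ m : M, x • m = 0 := by
    intro x hx m
    by_contra hm
    obtain ⟨y, hy⟩ := hspan _ hm m
    obtain ⟨k, hk⟩ := isNilpotent_of_map_eq_zero φ hφ (y * x) (by rw [map_mul, hx, mul_zero])
    have : ∀ j : ℕ, (y * x) ^ j • m = m := by
      intro j
      induction j with
      | zero => simp
      | succ j ih => rw [pow_succ, mul_smul, mul_smul, hy, ih]
    have h0 := this k
    rw [hk, zero_smul] at h0
    exact hm (by rw [← h0, smul_zero])
  have hcomm : ∀ (x y : descentAlgebra n p) (m : M), x • y • m = y • x • m := by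
    intro x y m
    have := hker (x * y - y * x) (by rw [map_sub, map_mul, map_mul, mul_comm, sub_self]) m
    rwa [sub_smul, sub_eq_zero, mul_smul, mul_smul] at this
  have hinj : ∀ x : descentAlgebra n p, (∃ m : M, x • m ≠ 0) → ∀ m : M, x • m = 0 → m = 0 := by
    rintro x ⟨m', hm'⟩ m hxm
    by_contra hm
    obtain ⟨y, rfl⟩ := hspan m hm m'
    exact hm' (by rw [hcomm, hxm, smul_zero])
  have hex : ∃ τ, ∀ x : descentAlgebra n p, φ x τ = 0 → ∀ m : M, x • m = 0 := by
    by_contra! hcon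
    choose x hx hxm using hcon
    have hprod : ∀ l : List (Equiv.Perm (Fin n)), ∀ m : M, (l.map x).prod • m = 0 → m = 0 := by
      intro l
      induction l with
      | nil => intro m hm; simpa using hm
      | cons τ l ih =>
        intro m hm
        rw [List.map_cons, List.prod_cons, mul_smul] at hm
        exact ih m (hinj _ (hxm τ) _ hm)
    have hzero : φ (((Finset.univ : Finset (Equiv.Perm (Fin n))).toList.map x).prod) = 0 := by
      rw [map_list_prod]
      funext τ
      rw [Pi.list_prod_apply]
      refine List.prod_eq_zero ?_
      simp only [List.mem_map, Finset.mem_toList, Finset.mem_univ, true_and]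
      exact ⟨φ (x τ), ⟨x τ, ⟨τ, rfl⟩, rfl⟩, hx τ⟩
    have := IsSimpleModule.nontrivial (descentAlgebra n p) M
    obtain ⟨m, hm⟩ := exists_ne (0 : M)
    exact hm (hprod _ m (hker _ hzero m))
  obtain ⟨τ, hτ⟩ := hex
  refine ⟨τ, fun x m => ?_⟩
  have h0 : φ (x - algebraMap _ _ (φ x τ)) τ = 0 := by
    rw [map_sub, AlgHom.commutes]
    exact sub_self _
  have := hτ _ h0 m
  rwa [sub_smul, sub_eq_zero, algebraMap_smul] at this

end Solomon

lemma exists_eq_map_apply_of_algHom {n p : ℕ} [Fact p.Prime]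
    (φ : descentAlgebra n p →ₐ[ZMod p] (Equiv.Perm (Fin n) → ZMod p))
    (hφ : ∀ q : Composition n, φ (BelS n p q) = youngCharMod n p q)
    (χ : descentAlgebra n p →ₐ[ZMod p] ZMod p) : ∃ τ, ∀ x, χ x = φ x τ := by
  let : Module (descentAlgebra n p) (ZMod p) := Module.compHom (ZMod p) χ.toRingHom
  have hsmul : ∀ (x : descentAlgebra n p) (c : ZMod p), x • c = χ x * c := fun _ _ => rfl
  have : IsScalarTower (ZMod p) (descentAlgebra n p) (ZMod p) :=
    ⟨fun a x c => by rw [hsmul, hsmul, map_smul, smul_eq_mul, smul_eq_mul, mul_assoc]⟩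
  have : IsSimpleModule (descentAlgebra n p) (ZMod p) := by
    refine isSimpleModule_iff_toSpanSingleton_surjective.2 ⟨inferInstance, fun m hm c => ?_⟩
    refine ⟨algebraMap _ _ (c * m⁻¹), ?_⟩
    rw [LinearMap.toSpanSingleton_apply, hsmul, AlgHom.commutes]
    exact inv_mul_cancel_right₀ hm c
  obtain ⟨τ, hτ⟩ := exists_smul_eq_of_isSimpleModule φ hφ (ZMod p)
  refine ⟨τ, fun x => ?_⟩
  have := hτ x 1
  rwa [hsmul, mul_one, smul_eq_mul, mul_one] at this

/-- For each partition `π` of `n`, with `σ_π` of cycle type `π`, the map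
`λ_π(x) = φ(x)(σ_π)` is an `F_p`-algebra homomorphism `Σ(n,p) → F_p`; the `λ_π` for
`p`-regular `π` are pairwise distinct; every irreducible representation of `Σ(n,p)` is
one-dimensional and equivalent to `λ_π` for some `p`-regular `π`; and `Σ(n,p)` has exactly
`g(n,p)` irreducible representations up to equivalence. -/
theorem stmt11 (n p : ℕ) (hn : 1 ≤ n) (hp : p.Prime)
    (φ : descentAlgebra n p →ₐ[ZMod p] (Equiv.Perm (Fin n) → ZMod p))
    (hφ : ∀ q : Composition n, φ (BelS n p q) = youngCharMod n p q)
    (σ : n.Partition → Equiv.Perm (Fin n))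
    (hσ : ∀ π : n.Partition, (σ π).partition.parts = π.parts) :
    (∀ π : n.Partition, ∃ f : descentAlgebra n p →ₐ[ZMod p] ZMod p,
      ∀ x : descentAlgebra n p, f x = φ x (σ π)) ∧
    (∀ π π' : n.Partition, (∀ i ∈ π.parts, ¬ p ∣ i) → (∀ i ∈ π'.parts, ¬ p ∣ i) →
      (∀ x : descentAlgebra n p, φ x (σ π) = φ x (σ π')) → π = π') ∧
    (∀ (M : Type) [AddCommGroup M] [Module (ZMod p) M] [Module (descentAlgebra n p) M]
        [IsScalarTower (ZMod p) (descentAlgebra n p) M],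
      IsSimpleModule (descentAlgebra n p) M →
        Module.finrank (ZMod p) M = 1 ∧
        ∃ π : n.Partition, (∀ i ∈ π.parts, ¬ p ∣ i) ∧
          ∀ (x : descentAlgebra n p) (m : M), x • m = φ x (σ π) • m) ∧
    Nat.card (descentAlgebra n p →ₐ[ZMod p] ZMod p) = gPart n p := by
  have : Fact p.Prime := ⟨hp⟩
  have hex : ∀ π : n.Partition, ∃ f : descentAlgebra n p →ₐ[ZMod p] ZMod p,
      ∀ x : descentAlgebra n p, f x = φ x (σ π) :=
    fun π => ⟨(Pi.evalAlgHom (ZMod p) _ (σ π)).comp φ, fun x => rfl⟩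
  have hdist : ∀ π π' : n.Partition, (∀ i ∈ π.parts, ¬ p ∣ i) → (∀ i ∈ π'.parts, ¬ p ∣ i) →
      (∀ x : descentAlgebra n p, φ x (σ π) = φ x (σ π')) → π = π' := by
    intro π π' hπ hπ' h
    refine Nat.Partition.ext ?_
    rw [← hσ π, ← hσ π']
    refine parts_eq_of_youngCharMod_eq (p := p) (by rwa [hσ]) (by rwa [hσ]) fun q => ?_
    rw [← hφ, h]
  refine ⟨hex, hdist, ?_, ?_⟩
  · intro M _ _ _ _ hM
    obtain ⟨τ, hτ⟩ := exists_smul_eq_of_isSimpleModule φ hφ M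
    obtain ⟨π, hπ, hπτ⟩ := exists_regular_partition φ hφ σ hσ τ
    refine ⟨?_, π, hπ, fun x m => by rw [hτ, hπτ]⟩
    have := IsSimpleModule.nontrivial (descentAlgebra n p) M
    obtain ⟨m, hm⟩ := exists_ne (0 : M)
    refine finrank_eq_one m hm fun m' => ?_
    obtain ⟨x, hx⟩ := IsSimpleModule.toSpanSingleton_surjective (descentAlgebra n p) hm m'
    exact ⟨φ x τ, by rw [← hτ]; exact hx⟩
  · choose f hf using hex
    rw [gPart, ← Nat.card_coe_set_eq]
    refine (Nat.card_congr (Equiv.ofBijective (fun π => f π.1) ⟨?_, ?_⟩)).symm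
    · rintro ⟨π, hπ⟩ ⟨π', hπ'⟩ h
      refine Subtype.ext (hdist π π' hπ hπ' fun x => ?_)
      rw [← hf, ← hf]
      exact DFunLike.congr_fun h x
    · intro χ
      obtain ⟨τ, hτ⟩ := exists_eq_map_apply_of_algHom φ hφ χ
      obtain ⟨π, hπ, hπτ⟩ := exists_regular_partition φ hφ σ hσ τ
      exact ⟨⟨π, hπ⟩, AlgHom.ext fun x => by rw [hτ, hπτ, hf]⟩

end
end
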